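/- Let k be a field and let I be a proper radical ideal of R = k[x,y,z]. Then either rt(I) = 1, or rt(I) = rt(I_2), where I_2 ≠ R is the second equidimensional component of I (the intersection of the height-2 primary components) and I_2 is syzygetic. Moreover, either rt(I) = 1 or rt(I) ≥ 3. -/

import Mathlib

open Polynomial MvPolynomial

/-- The kernel of the graded presentation `R[t₁,…,t_s] → 𝐑(I) ⊆ R[X]` of the Rees algebra
of the ideal generated by `f`, sending `tᵢ` to `(f i)·X`. -/
noncomputable def reesKer {R : Type*} [CommRing R] {s : ℕ} (f : Fin s → R) :
    Ideal (MvPolynomial (Fin s) R) :=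
  RingHom.ker (MvPolynomial.aeval
    (fun i => Polynomial.C (f i) * Polynomial.X) : MvPolynomial (Fin s) R →ₐ[R] Polynomial R)

/-- `L` is generated by its homogeneous elements of degree at most `N`. -/
def GenInDegLE {R : Type*} [CommRing R] {s : ℕ}
    (L : Ideal (MvPolynomial (Fin s) R)) (N : ℕ) : Prop :=
  L = Ideal.span {p | p ∈ L ∧ ∃ q ≤ N, MvPolynomial.IsHomogeneous p q}

/-- The relation type of an ideal `I`: the least `N ≥ 1` such that, for every finite
generating family of `I`, the ideal of equations of the corresponding presentation of the
Rees algebra is generated by its homogeneous elements of degree at most `N`. -/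
noncomputable def relType {R : Type*} [CommRing R] (I : Ideal R) : ℕ :=
  sInf {N | 1 ≤ N ∧ ∀ (s : ℕ) (f : Fin s → R),
    Ideal.span (Set.range f) = I → GenInDegLE (reesKer f) N}

/-- The height of an ideal `J` of `R`: the infimum of the heights (in the sense of lengths of
chains in `Spec R`) of the primes containing `J`. -/
noncomputable def idealHeight {R : Type*} [CommRing R] (J : Ideal R) : ℕ∞ :=
  ⨅ P : {P : PrimeSpectrum R // J ≤ P.asIdeal}, Order.height P.1

/-- For a radical ideal `I`, the `i`-th equidimensional component of `I`: the intersection of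
the (primary = prime, since `I` is radical) components of `I` of height `i`, i.e. of the minimal
primes of `I` of height `i`; it equals `R` (the whole ring) if there are none. -/
noncomputable def equidimComponent {R : Type*} [CommRing R] (I : Ideal R) (i : ℕ) : Ideal R :=
  sInf {P | P ∈ I.minimalPrimes ∧ idealHeight P = (i : ℕ∞)}

/-- An ideal `I` is *syzygetic* if the canonical map `α₂ : S₂(I) → I²` is an isomorphism;
equivalently, for every presentation of the Rees algebra of `I`, the degree-`2` equations are
generated by the linear ones (`L₂ = S₁·L₁`, i.e. `E(I)₂ = 0`). -/
def Syzygetic {R : Type*} [CommRing R] (I : Ideal R) : Prop :=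
  ∀ (s : ℕ) (f : Fin s → R), Ideal.span (Set.range f) = I →
    ∀ p ∈ reesKer f, p.IsHomogeneous 2 →
      p ∈ Ideal.span {q | q ∈ reesKer f ∧ q.IsHomogeneous 1}

/-- The ideal generated by the homogeneous elements of `L` of degree at most `N`. -/
noncomputable def lowDegreePart {R : Type*} [CommRing R] {s : ℕ}
    (L : Ideal (MvPolynomial (Fin s) R)) (N : ℕ) : Ideal (MvPolynomial (Fin s) R) :=
  Ideal.span {p | p ∈ L ∧ ∃ q ≤ N, MvPolynomial.IsHomogeneous p q}

section ReesKernel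

variable {R : Type*} [CommRing R] {s : ℕ}

lemma lowDegreePart_le (L : Ideal (MvPolynomial (Fin s) R)) (N : ℕ) : lowDegreePart L N ≤ L :=
  Ideal.span_le.2 fun _ hp => hp.1

lemma lowDegreePart_mono (L : Ideal (MvPolynomial (Fin s) R)) {M N : ℕ} (h : M ≤ N) :
    lowDegreePart L M ≤ lowDegreePart L N :=
  Ideal.span_mono fun _ ⟨hp, q, hq, hh⟩ => ⟨hp, q, hq.trans h, hh⟩

lemma genInDegLE_iff {L : Ideal (MvPolynomial (Fin s) R)} {N : ℕ} :
    GenInDegLE L N ↔ L ≤ lowDegreePart L N :=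
  ⟨fun h => h.le, fun h => le_antisymm h (lowDegreePart_le L N)⟩

lemma GenInDegLE.mono {L : Ideal (MvPolynomial (Fin s) R)} {M N : ℕ} (h : M ≤ N)
    (hL : GenInDegLE L M) : GenInDegLE L N :=
  genInDegLE_iff.2 ((genInDegLE_iff.1 hL).trans (lowDegreePart_mono L h))

lemma mem_reesKer {f : Fin s → R} {p : MvPolynomial (Fin s) R} :
    p ∈ reesKer f ↔ MvPolynomial.aeval
      (fun i => Polynomial.C (f i) * Polynomial.X : Fin s → R[X]) p = 0 := Iff.rfl

lemma aeval_C_mul_X_of_isHomogeneous (f : Fin s → R) {p : MvPolynomial (Fin s) R} {q : ℕ}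
    (hp : p.IsHomogeneous q) :
    MvPolynomial.aeval (fun i => Polynomial.C (f i) * Polynomial.X : Fin s → R[X]) p =
      Polynomial.C (MvPolynomial.eval f p) * Polynomial.X ^ q := by
  rw [MvPolynomial.aeval_def, MvPolynomial.eval₂_eq, MvPolynomial.eval_eq, map_sum, Finset.sum_mul]
  refine Finset.sum_congr rfl fun d hd => ?_
  rw [hp.degree_eq_sum_deg_support hd]
  simp only [mul_pow, Finset.prod_mul_distrib, map_mul, map_prod, map_pow,
    Finset.prod_pow_eq_pow_sum]
  rw [← mul_assoc]
  rfl

lemma mem_reesKer_of_isHomogeneous {f : Fin s → R} {p : MvPolynomial (Fin s) R} {q : ℕ}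
    (hp : p.IsHomogeneous q) : p ∈ reesKer f ↔ MvPolynomial.eval f p = 0 := by
  rw [mem_reesKer, aeval_C_mul_X_of_isHomogeneous f hp]
  constructor
  · intro h
    simpa using congrArg (Polynomial.coeff · q) h
  · intro h
    simp [h]

lemma homogeneousComponent_mem_reesKer {f : Fin s → R} {p : MvPolynomial (Fin s) R}
    (hp : p ∈ reesKer f) (q : ℕ) : p.homogeneousComponent q ∈ reesKer f := by
  rw [mem_reesKer_of_isHomogeneous (MvPolynomial.homogeneousComponent_isHomogeneous q p)]
  rw [mem_reesKer, ← MvPolynomial.sum_homogeneousComponent p, map_sum] at hp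
  have h := congrArg (Polynomial.coeff · q) hp
  simp only [aeval_C_mul_X_of_isHomogeneous f
    (MvPolynomial.homogeneousComponent_isHomogeneous _ p), Polynomial.finsetSum_coeff,
    Polynomial.coeff_C_mul_X_pow, Finset.sum_ite_eq, Polynomial.coeff_zero] at h
  split_ifs at h with hq
  · exact h
  · rw [MvPolynomial.homogeneousComponent_eq_zero, map_zero]
    simpa using hq

lemma reesKer_le_of_forall_isHomogeneous {f : Fin s → R} {T : Ideal (MvPolynomial (Fin s) R)}
    (h : ∀ p ∈ reesKer f, ∀ q, p.IsHomogeneous q → p ∈ T) : reesKer f ≤ T := by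
  intro p hp
  rw [← MvPolynomial.sum_homogeneousComponent p]
  exact T.sum_mem fun q _ => h _ (homogeneousComponent_mem_reesKer hp q) q
    (MvPolynomial.homogeneousComponent_isHomogeneous q p)

lemma lowDegreePart_one_eq (f : Fin s → R) : lowDegreePart (reesKer f) 1 =
    Ideal.span {p | p ∈ reesKer f ∧ p.IsHomogeneous 1} := by
  refine le_antisymm (Ideal.span_le.2 ?_)
    (Ideal.span_mono fun p hp => ⟨hp.1, 1, le_rfl, hp.2⟩)
  rintro p ⟨hp, q, hq, hh⟩
  obtain rfl | rfl : q = 0 ∨ q = 1 := by omega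
  · have hC : p = MvPolynomial.C (p.coeff 0) := by
      rw [← MvPolynomial.homogeneousComponent_zero, MvPolynomial.homogeneousComponent_eq_self hh]
    rw [mem_reesKer_of_isHomogeneous hh, hC, MvPolynomial.eval_C] at hp
    rw [hC, hp, map_zero]
    exact Ideal.zero_mem _
  · exact Ideal.subset_span ⟨hp, hh⟩

/-- Equations of the Rees algebra may be cleared of a common factor of the generators. -/
lemma reesKer_smul [IsDomain R] (f : Fin s → R) {a : R} (ha : a ≠ 0) :
    reesKer (fun i => a * f i) = reesKer f := by
  have key : ∀ p q, p.IsHomogeneous q →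
      (p ∈ reesKer (fun i => a * f i) ↔ p ∈ reesKer f) := by
    intro p q hp
    rw [mem_reesKer_of_isHomogeneous hp, mem_reesKer_of_isHomogeneous hp]
    have : MvPolynomial.eval (fun i => a * f i) p = a ^ q * MvPolynomial.eval f p := by
      rw [MvPolynomial.eval_eq, MvPolynomial.eval_eq, Finset.mul_sum]
      refine Finset.sum_congr rfl fun d hd => ?_
      rw [hp.degree_eq_sum_deg_support hd]
      simp only [mul_pow, Finset.prod_mul_distrib, Finset.prod_pow_eq_pow_sum]
      rw [mul_left_comm]
    rw [this, mul_eq_zero, or_iff_right (pow_ne_zero _ ha)]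
  exact le_antisymm
    (reesKer_le_of_forall_isHomogeneous fun p hp q hq => (key p q hq).1 hp)
    (reesKer_le_of_forall_isHomogeneous fun p hp q hq => (key p q hq).2 hp)

lemma aeval_sub_aeval_mem {σ A : Type*} [CommRing A] [Algebra R A] {T : Ideal A} {u v : σ → A}
    (h : ∀ i, u i - v i ∈ T) (p : MvPolynomial σ R) :
    MvPolynomial.aeval u p - MvPolynomial.aeval v p ∈ T := by
  rw [← Ideal.Quotient.eq, ← Ideal.Quotient.mkₐ_eq_mk R]
  rw [← AlgHom.comp_apply, ← AlgHom.comp_apply, MvPolynomial.comp_aeval, MvPolynomial.comp_aeval]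
  congr 2
  funext i
  exact Ideal.Quotient.eq.2 (h i)

lemma aeval_smul_X_of_isHomogeneous {p : MvPolynomial (Fin s) R} {q : ℕ}
    (hp : p.IsHomogeneous q) (a : R) :
    MvPolynomial.aeval (fun i => MvPolynomial.C a * MvPolynomial.X i :
      Fin s → MvPolynomial (Fin s) R) p = MvPolynomial.C (a ^ q) * p := by
  conv_rhs => rw [p.as_sum]
  rw [MvPolynomial.aeval_def, MvPolynomial.eval₂_eq, Finset.mul_sum]
  refine Finset.sum_congr rfl fun d hd => ?_
  rw [hp.degree_eq_sum_deg_support hd, MvPolynomial.monomial_eq]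
  simp only [mul_pow, Finset.prod_mul_distrib, Finset.prod_pow_eq_pow_sum,
    map_pow, Finsupp.prod]
  rw [mul_left_comm]
  rfl

/-- A linear change of generators. -/
lemma aeval_mem_reesKer {t : ℕ} {f : Fin s → R} {g : Fin t → R} {a : R}
    {c : Fin s → Fin t → R} (h : ∀ i, ∑ j, c i j * g j = a * f i)
    {p : MvPolynomial (Fin s) R} (hp : p ∈ reesKer f) {q : ℕ} (hq : p.IsHomogeneous q) :
    MvPolynomial.aeval (fun i => ∑ j, MvPolynomial.C (c i j) * MvPolynomial.X j :
      Fin s → MvPolynomial (Fin t) R) p ∈ reesKer g ∧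
    (MvPolynomial.aeval (fun i => ∑ j, MvPolynomial.C (c i j) * MvPolynomial.X j :
      Fin s → MvPolynomial (Fin t) R) p).IsHomogeneous q := by
  have hh : (MvPolynomial.aeval (fun i => ∑ j, MvPolynomial.C (c i j) * MvPolynomial.X j :
      Fin s → MvPolynomial (Fin t) R) p).IsHomogeneous q := by
    have := hq.aeval (fun i => ∑ j, MvPolynomial.C (c i j) * MvPolynomial.X j :
      Fin s → MvPolynomial (Fin t) R) (n := 1)
      (fun i => MvPolynomial.IsHomogeneous.sum _ _ _
        fun j _ => MvPolynomial.isHomogeneous_C_mul_X _ _)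
    simpa using this
  refine ⟨?_, hh⟩
  rw [mem_reesKer_of_isHomogeneous hq] at hp
  rw [mem_reesKer_of_isHomogeneous hh]
  have e1 : MvPolynomial.eval g (MvPolynomial.aeval
      (fun i => ∑ j, MvPolynomial.C (c i j) * MvPolynomial.X j :
        Fin s → MvPolynomial (Fin t) R) p) = MvPolynomial.eval (fun i => a * f i) p := by
    rw [← MvPolynomial.coe_aeval_eq_eval, ← MvPolynomial.coe_aeval_eq_eval]
    simp only [RingHom.coe_coe]
    rw [← AlgHom.comp_apply, MvPolynomial.comp_aeval]
    congr 2
    funext i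
    simp [← h i]
  have e2 := congrArg (MvPolynomial.eval f) (aeval_smul_X_of_isHomogeneous hq a)
  rw [map_mul, hp, mul_zero, ← MvPolynomial.coe_aeval_eq_eval] at e2
  simp only [RingHom.coe_coe] at e2
  rw [← AlgHom.comp_apply, MvPolynomial.comp_aeval] at e2
  rw [e1, ← MvPolynomial.coe_aeval_eq_eval]
  simpa using e2

/-- Comparison of the equations of two ideals that agree up to the factor `a`. -/
lemma pow_mul_mem_lowDegreePart {t : ℕ} {f : Fin s → R} {g : Fin t → R} {a : R}
    (hf : ∀ i, a * f i ∈ Ideal.span (Set.range g)) (hg : ∀ j, a * g j ∈ Ideal.span (Set.range f))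
    {N : ℕ} (hN : 1 ≤ N) (H : GenInDegLE (reesKer g) N)
    {p : MvPolynomial (Fin s) R} (hp : p ∈ reesKer f) {q : ℕ} (hq : p.IsHomogeneous q) :
    MvPolynomial.C ((a ^ 2) ^ q) * p ∈ lowDegreePart (reesKer f) N := by
  simp only [Ideal.mem_span_range_iff_exists_fun] at hf hg
  choose c hc using hf
  choose d hd using hg
  set φ := MvPolynomial.aeval (R := R) (fun i => ∑ j, MvPolynomial.C (c i j) * MvPolynomial.X j :
      Fin s → MvPolynomial (Fin t) R)
  set ψ := MvPolynomial.aeval (R := R) (fun i => ∑ j, MvPolynomial.C (d i j) * MvPolynomial.X j :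
      Fin t → MvPolynomial (Fin s) R) with hψ
  have h1 : ψ (φ p) ∈ lowDegreePart (reesKer f) N := by
    have hle : lowDegreePart (reesKer g) N ≤ (lowDegreePart (reesKer f) N).comap ψ := by
      refine Ideal.span_le.2 ?_
      rintro h ⟨hh, r, hr, hr'⟩
      obtain ⟨h3, h4⟩ := aeval_mem_reesKer hd hh hr'
      exact Ideal.subset_span ⟨h3, r, hr, h4⟩
    exact hle (genInDegLE_iff.1 H (aeval_mem_reesKer hc hp hq).1)
  have h2 : ψ (φ p) - MvPolynomial.aeval (fun i => MvPolynomial.C (a ^ 2) * MvPolynomial.X i :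
      Fin s → MvPolynomial (Fin s) R) p ∈ lowDegreePart (reesKer f) N := by
    rw [← AlgHom.comp_apply, MvPolynomial.comp_aeval]
    refine aeval_sub_aeval_mem (fun i => Ideal.subset_span ?_) p
    have hh : (ψ (∑ j, MvPolynomial.C (c i j) * MvPolynomial.X j) -
        MvPolynomial.C (a ^ 2) * MvPolynomial.X i).IsHomogeneous 1 := by
      refine MvPolynomial.IsHomogeneous.sub ?_ (MvPolynomial.isHomogeneous_C_mul_X _ _)
      have : (∑ j, MvPolynomial.C (c i j) * MvPolynomial.X j :
          MvPolynomial (Fin t) R).IsHomogeneous 1 := MvPolynomial.IsHomogeneous.sum _ _ _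
        fun j _ => MvPolynomial.isHomogeneous_C_mul_X _ _
      have := this.aeval (fun i => ∑ j, MvPolynomial.C (d i j) * MvPolynomial.X j :
        Fin t → MvPolynomial (Fin s) R) (n := 1)
        (fun i => MvPolynomial.IsHomogeneous.sum _ _ _
          fun j _ => MvPolynomial.isHomogeneous_C_mul_X _ _)
      simpa [hψ] using this
    refine ⟨?_, 1, hN, hh⟩
    rw [mem_reesKer_of_isHomogeneous hh]
    simp only [hψ, map_sum, map_mul, map_sub, MvPolynomial.aeval_X, MvPolynomial.eval_X,
      MvPolynomial.algHom_C, MvPolynomial.algebraMap_eq, MvPolynomial.eval_C, hd]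
    rw [Finset.sum_congr rfl fun j _ => mul_left_comm (c i j) a (g j), ← Finset.mul_sum, hc]
    ring
  rw [aeval_smul_X_of_isHomogeneous hq] at h2
  have := Ideal.sub_mem _ h1 h2
  simpa using this

/-- Generation in degree at most `N` may be checked locally, comparing the generators at every
maximal ideal with a family whose equations are generated in degree at most `N`. -/
lemma genInDegLE_of_locally {f : Fin s → R} {N : ℕ} (hN : 1 ≤ N)
    (H : ∀ m : Ideal R, m.IsMaximal → ∃ (t : ℕ) (g : Fin t → R) (a : R), a ∉ m ∧
      (∀ i, a * f i ∈ Ideal.span (Set.range g)) ∧ (∀ j, a * g j ∈ Ideal.span (Set.range f)) ∧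
      GenInDegLE (reesKer g) N) : GenInDegLE (reesKer f) N := by
  refine genInDegLE_iff.2 (reesKer_le_of_forall_isHomogeneous fun p hp q hq => ?_)
  by_contra hcon
  let c : Ideal R := ((lowDegreePart (reesKer f) N).colon {p}).comap MvPolynomial.C
  have hc : c ≠ ⊤ := by
    intro h
    have : (1 : R) ∈ c := h ▸ Submodule.mem_top
    rw [Ideal.mem_comap, Submodule.mem_colon_singleton] at this
    exact hcon (by simpa using this)
  obtain ⟨m, hm, hcm⟩ := Ideal.exists_le_maximal c hc
  obtain ⟨t, g, a, ham, h1, h2, h3⟩ := H m hm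
  have h4 := pow_mul_mem_lowDegreePart h1 h2 hN h3 hp hq
  have h5 : (a ^ 2) ^ q ∈ m := hcm (by
    rw [Ideal.mem_comap, Submodule.mem_colon_singleton]
    exact h4)
  exact ham (hm.isPrime.mem_of_pow_mem _ (hm.isPrime.mem_of_pow_mem _ h5))

lemma GenInDegLE.of_span_eq {t : ℕ} {f : Fin s → R} {g : Fin t → R}
    (h : Ideal.span (Set.range f) = Ideal.span (Set.range g)) {N : ℕ} (hN : 1 ≤ N)
    (H : GenInDegLE (reesKer g) N) : GenInDegLE (reesKer f) N :=
  genInDegLE_of_locally hN fun m hm => ⟨t, g, 1, (Ideal.ne_top_iff_one m).1 hm.ne_top,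
    fun i => by rw [one_mul, ← h]; exact Ideal.subset_span ⟨i, rfl⟩,
    fun j => by rw [one_mul, h]; exact Ideal.subset_span ⟨j, rfl⟩, H⟩

lemma exists_genInDegLE [IsNoetherianRing R] (f : Fin s → R) :
    ∃ N, 1 ≤ N ∧ GenInDegLE (reesKer f) N := by
  obtain ⟨S, hS⟩ := (isNoetherianRing_iff_ideal_fg _).1 inferInstance (reesKer f)
  refine ⟨S.sup MvPolynomial.totalDegree + 1, by omega, genInDegLE_iff.2 ?_⟩
  conv_lhs => rw [← hS]
  refine Ideal.span_le.2 fun p hp => ?_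
  rw [← MvPolynomial.sum_homogeneousComponent p]
  refine Ideal.sum_mem _ fun q hq => Ideal.subset_span
    ⟨homogeneousComponent_mem_reesKer (hS ▸ Ideal.subset_span hp) q, q, ?_,
      MvPolynomial.homogeneousComponent_isHomogeneous q p⟩
  have := Finset.le_sup (f := MvPolynomial.totalDegree) hp
  have := Finset.mem_range.1 hq
  omega

end ReesKernel

section RelType

variable {R : Type*} [CommRing R]

lemma relType_le_iff [IsNoetherianRing R] {s : ℕ} {f : Fin s → R} {I : Ideal R}
    (hf : Ideal.span (Set.range f) = I) {N : ℕ} (hN : 1 ≤ N) :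
    relType I ≤ N ↔ GenInDegLE (reesKer f) N := by
  constructor
  · intro h
    obtain ⟨M, hM, hM'⟩ := exists_genInDegLE f
    have hmem : relType I ∈ {N | 1 ≤ N ∧ ∀ (s : ℕ) (f : Fin s → R),
        Ideal.span (Set.range f) = I → GenInDegLE (reesKer f) N} :=
      Nat.sInf_mem ⟨M, hM, fun t g hg => hM'.of_span_eq (hg.trans hf.symm) hM⟩
    exact (hmem.2 s f hf).mono h
  · intro h
    exact Nat.sInf_le ⟨hN, fun t g hg => h.of_span_eq (hg.trans hf.symm) hN⟩

lemma exists_fin_span_eq [IsNoetherianRing R] (I : Ideal R) :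
    ∃ (s : ℕ) (f : Fin s → R), Ideal.span (Set.range f) = I :=
  Submodule.fg_iff_exists_fin_generating_family.1 (IsNoetherian.noetherian I)

lemma one_le_relType [IsNoetherianRing R] (I : Ideal R) : 1 ≤ relType I := by
  obtain ⟨s, f, hf⟩ := exists_fin_span_eq I
  obtain ⟨M, hM, hM'⟩ := exists_genInDegLE f
  have hmem : relType I ∈ {N | 1 ≤ N ∧ ∀ (s : ℕ) (f : Fin s → R),
      Ideal.span (Set.range f) = I → GenInDegLE (reesKer f) N} :=
    Nat.sInf_mem ⟨M, hM, fun t g hg => hM'.of_span_eq (hg.trans hf.symm) hM⟩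
  exact hmem.1

/-- The relation type of a syzygetic ideal is never `2`. -/
lemma Syzygetic.relType_eq_one_or [IsNoetherianRing R] {I : Ideal R} (hI : Syzygetic I) :
    relType I = 1 ∨ 3 ≤ relType I := by
  have h1 := one_le_relType I
  by_contra! hcon
  have h2 : relType I = 2 := by omega
  obtain ⟨s, f, hf⟩ := exists_fin_span_eq I
  have h3 := (relType_le_iff hf one_le_two).1 h2.le
  have h4 : GenInDegLE (reesKer f) 1 := by
    refine genInDegLE_iff.2 ((genInDegLE_iff.1 h3).trans (Ideal.span_le.2 ?_))
    rintro p ⟨hp, q, hq, hh⟩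
    obtain hq | rfl : q ≤ 1 ∨ q = 2 := by omega
    · exact Ideal.subset_span ⟨hp, q, hq, hh⟩
    · rw [SetLike.mem_coe, lowDegreePart_one_eq]
      exact hI s f hf p hp hh
  have := (relType_le_iff hf le_rfl).2 h4
  omega

end RelType

section RegularSequences

variable {R : Type*} [CommRing R]

/-- `f (n - 1), …, f 1, f 0` is a weakly regular sequence. -/
def RegularFamily : ∀ {n : ℕ}, (Fin n → R) → Prop
  | 0, _ => True
  | _ + 1, f => RegularFamily (Fin.tail f) ∧ ∀ u, f 0 * u ∈ Ideal.span (Set.range (Fin.tail f)) →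
      u ∈ Ideal.span (Set.range (Fin.tail f))

lemma RegularFamily.map {S : Type*} [CommRing S] (φ : R →+* S)
    (hφ : ∀ (J : Ideal R) (a : R), (∀ u, a * u ∈ J → u ∈ J) →
      ∀ u, φ a * u ∈ J.map φ → u ∈ J.map φ) :
    ∀ {n : ℕ} {f : Fin n → R}, RegularFamily f → RegularFamily (φ ∘ f)
  | 0, _, _ => trivial
  | n + 1, f, h => by
    refine ⟨RegularFamily.map φ hφ (f := Fin.tail f) h.1, ?_⟩
    have : Ideal.span (Set.range (Fin.tail (φ ∘ f))) =
        (Ideal.span (Set.range (Fin.tail f))).map φ := by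
      rw [Ideal.map_span, ← Set.range_comp]
      rfl
    rw [this]
    exact hφ _ _ h.2

/-- The linear syzygies of `g` have coefficients in the ideal generated by `g`, and they generate
all the equations of the Rees algebra. -/
def LinearTypeFamily {n : ℕ} (g : Fin n → R) : Prop :=
  GenInDegLE (reesKer g) 1 ∧
    ∀ c : Fin n → R, ∑ i, c i * g i = 0 → ∀ i, c i ∈ Ideal.span (Set.range g)

lemma LinearTypeFamily.reesKer_le {n : ℕ} {g : Fin n → R} (hg : LinearTypeFamily g) :
    reesKer g ≤ (Ideal.span (Set.range g)).map MvPolynomial.C := by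
  refine (genInDegLE_iff.1 hg.1).trans ?_
  rw [lowDegreePart_one_eq]
  refine Ideal.span_le.2 ?_
  rintro p ⟨hp, hh⟩
  rw [mem_reesKer_of_isHomogeneous hh] at hp
  have hp' := hh
  rw [← MvPolynomial.mem_homogeneousSubmodule, MvPolynomial.homogeneousSubmodule_one_eq_span_X,
    Submodule.mem_span_range_iff_exists_fun] at hp'
  obtain ⟨c, rfl⟩ := hp'
  refine Ideal.sum_mem _ fun i _ => ?_
  rw [MvPolynomial.smul_eq_C_mul]
  exact Ideal.mul_mem_right _ _ (Ideal.mem_map_of_mem _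
    (hg.2 c (by simpa [MvPolynomial.smul_eval] using hp) i))

lemma LinearTypeFamily.mem_pow {n : ℕ} {g : Fin n → R} (hg : LinearTypeFamily g) {a : R}
    (ha : ∀ u, a * u ∈ Ideal.span (Set.range g) → u ∈ Ideal.span (Set.range g)) (q : ℕ) :
    ∀ u, a * u ∈ Ideal.span (Set.range g) ^ q → u ∈ Ideal.span (Set.range g) ^ q := by
  induction q with
  | zero => simp
  | succ q ih =>
    intro u hu
    obtain ⟨U, hU, rfl⟩ := (Ideal.mem_span_pow_iff_exists_isHomogeneous g u).1
      (ih u (Ideal.pow_le_pow_right q.le_succ hu))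
    rw [pow_succ'] at hu
    have key : ∀ w ∈ Ideal.span (Set.range g) * Ideal.span (Set.range g) ^ q,
        ∃ V : MvPolynomial (Fin n) R, V.IsHomogeneous q ∧ MvPolynomial.eval g V = w ∧
          V ∈ (Ideal.span (Set.range g)).map MvPolynomial.C := by
      intro w hw
      induction hw using Submodule.mul_induction_on' with
      | mem_mul_mem r hr s hs =>
        obtain ⟨S, hS, rfl⟩ := (Ideal.mem_span_pow_iff_exists_isHomogeneous g s).1 hs
        exact ⟨MvPolynomial.C r * S, hS.C_mul r, by simp,
          Ideal.mul_mem_right _ _ (Ideal.mem_map_of_mem _ hr)⟩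
      | add x _ y _ hx hy =>
        obtain ⟨V, h1, h2, h3⟩ := hx
        obtain ⟨W, h4, h5, h6⟩ := hy
        exact ⟨V + W, h1.add h4, by simp [h2, h5], Ideal.add_mem _ h3 h6⟩
    obtain ⟨V, hV, hV1, hV2⟩ := key _ hu
    have h1 : MvPolynomial.C a * U - V ∈ reesKer g := by
      rw [mem_reesKer_of_isHomogeneous ((hU.C_mul a).sub hV)]
      simp [hV1]
    have h2 : MvPolynomial.C a * U ∈ (Ideal.span (Set.range g)).map MvPolynomial.C := by
      simpa using Ideal.add_mem _ (hg.reesKer_le h1) hV2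
    rw [MvPolynomial.mem_map_C_iff] at h2
    rw [MvPolynomial.eval_eq, pow_succ']
    refine Ideal.sum_mem _ fun d hd => Ideal.mul_mem_mul (ha _ ?_) ?_
    · simpa using h2 d
    · rw [hU.degree_eq_sum_deg_support hd, ← Finset.prod_pow_eq_pow_sum]
      exact Ideal.prod_mem_prod fun i _ =>
        Ideal.pow_mem_pow (Ideal.subset_span (Set.mem_range_self i)) _

lemma finSuccEquiv_rename_succ {n : ℕ} (p : MvPolynomial (Fin n) R) :
    MvPolynomial.finSuccEquiv R n (MvPolynomial.rename Fin.succ p) = Polynomial.C p := by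
  induction p using MvPolynomial.induction_on with
  | C a => simp [MvPolynomial.finSuccEquiv_apply]
  | add p q hp hq => simp [hp, hq]
  | mul_X p i hp => simp [hp, MvPolynomial.finSuccEquiv_X_succ]

lemma exists_eq_X_zero_mul_add {n q : ℕ} {F : MvPolynomial (Fin (n + 1)) R}
    (hF : F.IsHomogeneous (q + 1)) : ∃ (G : MvPolynomial (Fin (n + 1)) R)
      (H : MvPolynomial (Fin n) R), G.IsHomogeneous q ∧ H.IsHomogeneous (q + 1) ∧
      F = MvPolynomial.X 0 * G + MvPolynomial.rename Fin.succ H := by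
  set P := MvPolynomial.finSuccEquiv R n F with hP
  have hH : (P.coeff 0).IsHomogeneous (q + 1) :=
    hF.finSuccEquiv_coeff_isHomogeneous 0 (q + 1) (by omega)
  have hFe : F = MvPolynomial.X 0 * (MvPolynomial.finSuccEquiv R n).symm P.divX +
      MvPolynomial.rename Fin.succ (P.coeff 0) := by
    apply (MvPolynomial.finSuccEquiv R n).injective
    rw [map_add, map_mul, AlgEquiv.apply_symm_apply, MvPolynomial.finSuccEquiv_X_zero,
      finSuccEquiv_rename_succ, ← hP, Polynomial.X_mul_divX_add]
  refine ⟨_, _, ?_, hH, hFe⟩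
  have h1 : (MvPolynomial.X 0 * (MvPolynomial.finSuccEquiv R n).symm P.divX).IsHomogeneous
      (q + 1) := by
    have := hF.sub (hH.rename_isHomogeneous (f := Fin.succ))
    rwa [sub_eq_of_eq_add hFe] at this
  intro d hd
  rw [← MvPolynomial.coeff_X_mul d 0] at hd
  have := h1 hd
  simp only [map_add, Finsupp.weight_single, Pi.one_apply, smul_eq_mul, mul_one] at this
  omega

lemma X_zero_mul_sub_mem {n : ℕ} (g : Fin n → R) (a : R) (e : Fin n → R)
    (S : MvPolynomial (Fin n) R) :
    MvPolynomial.X 0 * MvPolynomial.rename Fin.succ (MvPolynomial.C (∑ i, e i * g i) * S) -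
      MvPolynomial.C a * MvPolynomial.rename Fin.succ
        ((∑ i, MvPolynomial.C (e i) * MvPolynomial.X i) * S) ∈
      lowDegreePart (reesKer (Fin.cons a g : Fin (n + 1) → R)) 1 := by
  have : MvPolynomial.X 0 * MvPolynomial.rename Fin.succ
        (MvPolynomial.C (∑ i, e i * g i) * S) - MvPolynomial.C a *
      MvPolynomial.rename Fin.succ ((∑ i, MvPolynomial.C (e i) * MvPolynomial.X i) * S) =
      (∑ i, MvPolynomial.C (e i) * (MvPolynomial.C (g i) * MvPolynomial.X 0 -
        MvPolynomial.C a * MvPolynomial.X i.succ)) * MvPolynomial.rename Fin.succ S := by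
    have h : ∑ i, MvPolynomial.C (e i) * (MvPolynomial.C (g i) * MvPolynomial.X 0 -
        MvPolynomial.C a * MvPolynomial.X i.succ) =
        MvPolynomial.X 0 * MvPolynomial.C (∑ i, e i * g i) -
          MvPolynomial.C a * ∑ i, MvPolynomial.C (e i) *
            (MvPolynomial.X i.succ : MvPolynomial (Fin (n + 1)) R) := by
      rw [map_sum, Finset.mul_sum, Finset.mul_sum, ← Finset.sum_sub_distrib]
      refine Finset.sum_congr rfl fun i _ => ?_
      rw [map_mul]
      ring
    rw [h]
    simp only [map_mul, map_sum, MvPolynomial.rename_C, MvPolynomial.rename_X]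
    ring
  rw [this]
  refine Ideal.mul_mem_right _ _ (Ideal.sum_mem _ fun i _ => Ideal.mul_mem_left _ _
    (Ideal.subset_span ?_))
  have hh : (MvPolynomial.C (g i) * MvPolynomial.X 0 -
        MvPolynomial.C a * MvPolynomial.X i.succ :
        MvPolynomial (Fin (n + 1)) R).IsHomogeneous 1 :=
    (MvPolynomial.isHomogeneous_C_mul_X _ _).sub (MvPolynomial.isHomogeneous_C_mul_X _ _)
  refine ⟨(mem_reesKer_of_isHomogeneous hh).2 ?_, 1, le_rfl, hh⟩
  simp [mul_comm]

lemma exists_transfer_form {n : ℕ} (g : Fin n → R) (a : R) (q : ℕ) :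
    ∀ w ∈ Ideal.span (Set.range g) * Ideal.span (Set.range g) ^ q,
      ∃ W W₀ : MvPolynomial (Fin n) R, W.IsHomogeneous q ∧ W₀.IsHomogeneous (q + 1) ∧
        MvPolynomial.eval g W = w ∧
        MvPolynomial.X 0 * MvPolynomial.rename Fin.succ W -
          MvPolynomial.C a * MvPolynomial.rename Fin.succ W₀ ∈
          lowDegreePart (reesKer (Fin.cons a g : Fin (n + 1) → R)) 1 := by
  intro w hw
  induction hw using Submodule.mul_induction_on' with
  | mem_mul_mem r hr s hs =>
    obtain ⟨S, hS, rfl⟩ := (Ideal.mem_span_pow_iff_exists_isHomogeneous g s).1 hs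
    obtain ⟨e, rfl⟩ := Ideal.mem_span_range_iff_exists_fun.1 hr
    refine ⟨MvPolynomial.C (∑ i, e i * g i) * S,
      (∑ i, MvPolynomial.C (e i) * MvPolynomial.X i) * S, hS.C_mul _, ?_, by simp,
      X_zero_mul_sub_mem g a e S⟩
    rw [add_comm]
    exact (MvPolynomial.IsHomogeneous.sum _ _ _ fun i _ =>
      MvPolynomial.isHomogeneous_C_mul_X _ _).mul hS
  | add x _ y _ hx hy =>
    obtain ⟨V, V₀, h1, h2, h3, h4⟩ := hx
    obtain ⟨W, W₀, h5, h6, h7, h8⟩ := hy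
    refine ⟨V + W, V₀ + W₀, h1.add h5, h2.add h6, by simp [h3, h7], ?_⟩
    have : MvPolynomial.X 0 * MvPolynomial.rename Fin.succ (V + W) -
        MvPolynomial.C a * MvPolynomial.rename Fin.succ (V₀ + W₀) =
        (MvPolynomial.X 0 * MvPolynomial.rename Fin.succ V -
          MvPolynomial.C a * MvPolynomial.rename Fin.succ V₀) +
        (MvPolynomial.X 0 * MvPolynomial.rename Fin.succ W -
          MvPolynomial.C a * MvPolynomial.rename Fin.succ W₀) := by
      simp only [map_add]
      ring
    rw [this]
    exact Ideal.add_mem _ h4 h8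

lemma LinearTypeFamily.cons {n : ℕ} {g : Fin n → R} (hg : LinearTypeFamily g) {a : R}
    (ha : ∀ u, a * u ∈ Ideal.span (Set.range g) → u ∈ Ideal.span (Set.range g)) :
    LinearTypeFamily (Fin.cons a g : Fin (n + 1) → R) := by
  set v : Fin (n + 1) → R := Fin.cons a g with hv
  have hren : ∀ H : MvPolynomial (Fin n) R,
      MvPolynomial.eval v (MvPolynomial.rename Fin.succ H) = MvPolynomial.eval g H := by
    intro H
    rw [MvPolynomial.eval_rename]
    rfl
  set T := lowDegreePart (reesKer v) 1 with hT
  have hTv : ∀ p ∈ T, MvPolynomial.eval v p = 0 := by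
    intro p hp
    have h0 := lowDegreePart_le _ _ hp
    rw [← MvPolynomial.sum_homogeneousComponent p, map_sum]
    exact Finset.sum_eq_zero fun q _ => (mem_reesKer_of_isHomogeneous
      (MvPolynomial.homogeneousComponent_isHomogeneous q p)).1
        (homogeneousComponent_mem_reesKer h0 q)
  have key := exists_transfer_form g a
  have hrenT : ∀ p ∈ reesKer g, MvPolynomial.rename Fin.succ p ∈ T := by
    intro p hp
    have hle : lowDegreePart (reesKer g) 1 ≤ T.comap (MvPolynomial.rename Fin.succ) := by
      refine Ideal.span_le.2 ?_
      rintro h ⟨hh, r, hr, hr'⟩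
      refine Ideal.subset_span ⟨(mem_reesKer_of_isHomogeneous hr'.rename_isHomogeneous).2 ?_, r, hr,
        hr'.rename_isHomogeneous⟩
      rw [hren]
      exact (mem_reesKer_of_isHomogeneous hr').1 hh
    exact hle (genInDegLE_iff.1 hg.1 hp)
  have main : ∀ (q : ℕ) (F : MvPolynomial (Fin (n + 1)) R), F.IsHomogeneous q →
      MvPolynomial.eval v F = 0 → F ∈ T := by
    intro q
    induction q with
    | zero =>
      intro F hF h0
      exact Ideal.subset_span ⟨(mem_reesKer_of_isHomogeneous hF).2 h0, 0, Nat.zero_le _, hF⟩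
    | succ q ih =>
      intro F hF h0
      obtain ⟨G, H, hG, hH, rfl⟩ := exists_eq_X_zero_mul_add hF
      have h1 : a * MvPolynomial.eval v G + MvPolynomial.eval g H = 0 := by
        rwa [map_add, map_mul, hren, MvPolynomial.eval_X] at h0
      have h2 : MvPolynomial.eval v G ∈ Ideal.span (Set.range g) ^ (q + 1) := by
        refine hg.mem_pow ha _ _ ?_
        rw [eq_neg_of_add_eq_zero_left h1]
        exact neg_mem ((Ideal.mem_span_pow_iff_exists_isHomogeneous g _).2 ⟨H, hH, rfl⟩)
      rw [pow_succ'] at h2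
      obtain ⟨W, W₀, hW, hW₀, hWe, hWT⟩ := key q _ h2
      have h3 : G - MvPolynomial.rename Fin.succ W ∈ T :=
        ih _ (hG.sub hW.rename_isHomogeneous) (by rw [map_sub, hren, hWe, sub_self])
      have h4 : MvPolynomial.rename Fin.succ (H + MvPolynomial.C a * W₀) ∈ T := by
        refine hrenT _ ((mem_reesKer_of_isHomogeneous (hH.add (hW₀.C_mul a))).2 ?_)
        have := hTv _ hWT
        simp only [map_sub, map_mul, hren, MvPolynomial.eval_X, MvPolynomial.eval_C, hWe] at this
        simp only [map_add, map_mul, MvPolynomial.eval_C]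
        simp only [hv, Fin.cons_zero] at this h1
        linear_combination h1 - this
      have : MvPolynomial.X 0 * G + MvPolynomial.rename Fin.succ H =
          MvPolynomial.X 0 * (G - MvPolynomial.rename Fin.succ W) +
          (MvPolynomial.X 0 * MvPolynomial.rename Fin.succ W -
          MvPolynomial.C a * MvPolynomial.rename Fin.succ W₀) +
          MvPolynomial.rename Fin.succ (H + MvPolynomial.C a * W₀) := by
        simp only [map_add, map_mul, MvPolynomial.rename_C]
        ring
      rw [this]
      exact Ideal.add_mem _ (Ideal.add_mem _ (Ideal.mul_mem_left _ _ h3) hWT) h4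
  refine ⟨genInDegLE_iff.2 (reesKer_le_of_forall_isHomogeneous fun p hp q hq =>
    main q p hq ((mem_reesKer_of_isHomogeneous hq).1 hp)), ?_⟩
  intro c hc
  have hle : Ideal.span (Set.range g) ≤ Ideal.span (Set.range v) :=
    Ideal.span_mono (by rintro _ ⟨i, rfl⟩; exact ⟨i.succ, by simp [hv]⟩)
  rw [Fin.sum_univ_succ] at hc
  simp only [hv, Fin.cons_zero, Fin.cons_succ] at hc
  have h0 : c 0 ∈ Ideal.span (Set.range g) := by
    refine ha _ ?_
    rw [mul_comm, eq_neg_of_add_eq_zero_left hc]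
    exact neg_mem (Ideal.mem_span_range_iff_exists_fun.2 ⟨_, rfl⟩)
  obtain ⟨e, he⟩ := Ideal.mem_span_range_iff_exists_fun.1 h0
  have h1 := hg.2 (fun i => c i.succ + a * e i) (by
    simp only [add_mul, Finset.sum_add_distrib, mul_assoc, ← Finset.mul_sum, he]
    linear_combination hc)
  intro i
  refine Fin.cases (hle h0) (fun i => ?_) i
  have h2 : a * e i ∈ Ideal.span (Set.range v) :=
    Ideal.mul_mem_right _ _ (Ideal.subset_span ⟨0, by simp [hv]⟩)
  simpa using Ideal.sub_mem _ (hle (h1 i)) h2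

lemma linearTypeFamily_of_isEmpty (g : Fin 0 → R) : LinearTypeFamily g := by
  refine ⟨genInDegLE_iff.2 (reesKer_le_of_forall_isHomogeneous fun p hp q hq => ?_), fun c _ i =>
    i.elim0⟩
  exact Ideal.subset_span ⟨hp, 0, Nat.zero_le _, MvPolynomial.isHomogeneous_of_isEmpty _ _ p⟩

/-- Ideals generated by a regular sequence are of linear type. -/
lemma RegularFamily.linearTypeFamily :
    ∀ {n : ℕ} {f : Fin n → R}, RegularFamily f → LinearTypeFamily f
  | 0, f, _ => linearTypeFamily_of_isEmpty f
  | n + 1, f, h => by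
    have := (RegularFamily.linearTypeFamily h.1).cons h.2
    rwa [Fin.cons_self_tail] at this

end RegularSequences

section MaximalIdeals

/-- Every maximal ideal of `R` has height `n` and is generated by a regular sequence of
length `n`. -/
def MaximalIdealsRegular (R : Type*) [CommRing R] (n : ℕ) : Prop :=
  ∀ m : Ideal R, m.IsMaximal →
    m.height = n ∧ ∃ f : Fin n → R, Ideal.span (Set.range f) = m ∧ RegularFamily f

lemma MaximalIdealsRegular.of_ringEquiv {R S : Type*} [CommRing R] [CommRing S] {n : ℕ}
    (h : MaximalIdealsRegular R n) (e : R ≃+* S) : MaximalIdealsRegular S n := by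
  intro m hm
  have hmap : (m.comap (e : R →+* S)).map (e : R →+* S) = m :=
    Ideal.map_comap_of_surjective _ e.surjective m
  have hmax : (m.comap (e : R →+* S)).IsMaximal :=
    Ideal.comap_isMaximal_of_surjective _ e.surjective
  obtain ⟨h1, f, h2, h3⟩ := h _ hmax
  refine ⟨?_, e ∘ f, ?_, ?_⟩
  · rw [← h1]
    exact (e.height_comap m).symm
  · rw [← hmap, ← h2, Ideal.map_span, ← Set.range_comp]
    rfl
  · refine h3.map (e : R →+* S) fun J a ha u hu => ?_
    rw [show ((e : R →+* S)) = RingHomClass.toRingHom e from rfl] at *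
    have key : ∀ u, u ∈ J.map e ↔ e.symm u ∈ J := by
      intro u
      rw [← Ideal.comap_symm]
      rfl
    refine (key u).2 (ha _ ?_)
    simpa using (key _).1 hu

lemma MaximalIdealsRegular.polynomial {R : Type*} [CommRing R] [IsNoetherianRing R]
    [IsJacobsonRing R] {n : ℕ} (h : MaximalIdealsRegular R n) :
    MaximalIdealsRegular R[X] (n + 1) := by
  intro m hm
  set p := m.comap (Polynomial.C : R →+* R[X]) with hp
  have hpm : p.IsMaximal := Polynomial.isMaximal_comap_C_of_isJacobsonRing m
  have : m.LiesOver p := ⟨rfl⟩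
  obtain ⟨h1, g, h2, h3⟩ := h p hpm
  have hht := Polynomial.height_eq_height_add_one p m
  have hne : m ≠ p.map Polynomial.C := by
    intro heq
    rw [heq, Polynomial.height_map_C, h1] at hht
    exact absurd hht (by norm_cast; omega)
  obtain ⟨y, hy, hy'⟩ := Polynomial.exists_monic_span_sup_map_eq R m hpm (by simpa using hne)
  refine ⟨by rw [hht, h1]; norm_cast, Fin.cons y (Polynomial.C ∘ g), ?_, ?_, ?_⟩
  · rw [Fin.range_cons, Ideal.span_insert, Set.range_comp, ← Ideal.map_span, h2, sup_comm]
    exact hy'.symm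
  · rw [Fin.tail_cons]
    refine h3.map Polynomial.C fun J a ha u hu => ?_
    rw [Ideal.mem_map_C_iff] at hu ⊢
    exact fun i => ha _ (by simpa using hu i)
  · rw [Fin.tail_cons, Fin.cons_zero, Set.range_comp, ← Ideal.map_span, h2]
    intro u hu
    have hker : p.map Polynomial.C = RingHom.ker (Polynomial.mapRingHom (Ideal.Quotient.mk p)) := by
      rw [Polynomial.ker_mapRingHom, Ideal.mk_ker]
    rw [hker, RingHom.mem_ker] at hu ⊢
    rw [map_mul] at hu
    exact (mul_eq_zero.1 hu).resolve_left (hy.map (Ideal.Quotient.mk p)).ne_zero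

lemma maximalIdealsRegular_mvPolynomial (k : Type*) [Field k] (n : ℕ) :
    MaximalIdealsRegular (MvPolynomial (Fin n) k) n := by
  induction n with
  | zero =>
    have hk : MaximalIdealsRegular k 0 := by
      intro m hm
      have := m.eq_bot_of_prime
      subst this
      exact ⟨by simp, Fin.elim0, by simp, trivial⟩
    exact hk.of_ringEquiv (MvPolynomial.isEmptyRingEquiv k (Fin 0)).symm
  | succ n ih => exact ih.polynomial.of_ringEquiv (MvPolynomial.finSuccEquiv k n).symm.toRingEquiv

end MaximalIdeals

section QuadraticForms

variable {R : Type*} [CommRing R] {n : ℕ}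

/-- The quadratic form with matrix `U`. -/
noncomputable def quadForm (U : Matrix (Fin n) (Fin n) R) : MvPolynomial (Fin n) R :=
  ∑ i, ∑ j, MvPolynomial.C (U i j) * MvPolynomial.X i * MvPolynomial.X j

lemma quadForm_add (U V : Matrix (Fin n) (Fin n) R) :
    quadForm (U + V) = quadForm U + quadForm V := by
  simp [quadForm, Finset.sum_add_distrib, add_mul]

lemma quadForm_sub (U V : Matrix (Fin n) (Fin n) R) :
    quadForm (U - V) = quadForm U - quadForm V := by
  simp [quadForm, Finset.sum_sub_distrib, sub_mul]

lemma quadForm_smul (a : R) (U : Matrix (Fin n) (Fin n) R) :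
    quadForm (a • U) = MvPolynomial.C a * quadForm U := by
  simp [quadForm, Finset.mul_sum, mul_assoc]

lemma quadForm_transpose (U : Matrix (Fin n) (Fin n) R) :
    quadForm U.transpose = quadForm U := by
  rw [quadForm, quadForm, Finset.sum_comm]
  refine Finset.sum_congr rfl fun i _ => Finset.sum_congr rfl fun j _ => ?_
  rw [Matrix.transpose_apply]
  ring

lemma eval_quadForm (U : Matrix (Fin n) (Fin n) R) (v : Fin n → R) :
    MvPolynomial.eval v (quadForm U) = v ⬝ᵥ U.mulVec v := by
  simp only [quadForm, map_sum, map_mul, MvPolynomial.eval_C, MvPolynomial.eval_X, dotProduct,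
    Matrix.mulVec, Finset.mul_sum]
  exact Finset.sum_congr rfl fun i _ => Finset.sum_congr rfl fun j _ => by ring

lemma exists_linear_form {p : MvPolynomial (Fin n) R} (hp : p.IsHomogeneous 1) :
    ∃ c : Fin n → R, p = ∑ i, MvPolynomial.C (c i) * MvPolynomial.X i := by
  rw [← MvPolynomial.mem_homogeneousSubmodule, MvPolynomial.homogeneousSubmodule_one_eq_span_X,
    Submodule.mem_span_range_iff_exists_fun] at hp
  obtain ⟨c, rfl⟩ := hp
  exact ⟨c, by simp only [MvPolynomial.smul_eq_C_mul]⟩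

lemma homogeneousComponent_succ_mul {l : MvPolynomial (Fin n) R} (hl : l.IsHomogeneous 1)
    (a : MvPolynomial (Fin n) R) (q : ℕ) :
    (a * l).homogeneousComponent (q + 1) = a.homogeneousComponent q * l := by
  conv_lhs => rw [← MvPolynomial.sum_homogeneousComponent a, Finset.sum_mul, map_sum]
  have h : ∀ i, MvPolynomial.homogeneousComponent (q + 1) (a.homogeneousComponent i * l) =
      if i = q then a.homogeneousComponent q * l else 0 := by
    intro i
    rw [MvPolynomial.homogeneousComponent_of_mem
      ((MvPolynomial.homogeneousComponent_isHomogeneous i a).mul hl)]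
    by_cases hi : i = q
    · simp [hi]
    · rw [if_neg (by omega), if_neg hi]
  simp only [h, Finset.sum_ite_eq', Finset.mem_range]
  split_ifs with hq
  · rfl
  · rw [MvPolynomial.homogeneousComponent_eq_zero q a (by omega), zero_mul]

lemma exists_quadForm_of_mem {f : Fin n → R} {p : MvPolynomial (Fin n) R}
    (hp : p.IsHomogeneous 2) (hpT : p ∈ lowDegreePart (reesKer f) 1) :
    ∃ U : Matrix (Fin n) (Fin n) R, Matrix.vecMul f U = 0 ∧ p = quadForm U := by
  suffices h : ∀ a : MvPolynomial (Fin n) R, ∃ U : Matrix (Fin n) (Fin n) R,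
      Matrix.vecMul f U = 0 ∧ (a * p).homogeneousComponent 2 = quadForm U by
    simpa [MvPolynomial.homogeneousComponent_eq_self hp] using h 1
  rw [lowDegreePart_one_eq] at hpT
  clear hp
  induction hpT using Submodule.span_induction with
  | mem l hl =>
    intro a
    obtain ⟨hl, hh⟩ := hl
    rw [homogeneousComponent_succ_mul hh]
    rw [mem_reesKer_of_isHomogeneous hh] at hl
    obtain ⟨c, rfl⟩ := exists_linear_form hh
    obtain ⟨d, hd⟩ := exists_linear_form (MvPolynomial.homogeneousComponent_isHomogeneous 1 a)
    have hc : f ⬝ᵥ c = 0 := by simpa [dotProduct, mul_comm] using hl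
    refine ⟨Matrix.vecMulVec c d, ?_, ?_⟩
    · rw [Matrix.vecMul_vecMulVec, hc, zero_smul]
    · rw [hd, quadForm, mul_comm, Finset.sum_mul_sum]
      refine Finset.sum_congr rfl fun i _ => Finset.sum_congr rfl fun j _ => ?_
      rw [Matrix.vecMulVec_apply, map_mul]
      ring
  | zero => exact fun a => ⟨0, by simp, by simp [quadForm]⟩
  | add b c _ _ hb hc =>
    intro a
    obtain ⟨U, hU, hU'⟩ := hb a
    obtain ⟨V, hV, hV'⟩ := hc a
    exact ⟨U + V, by rw [Matrix.vecMul_add, hU, hV, add_zero],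
      by rw [mul_add, map_add, hU', hV', quadForm_add]⟩
  | smul b l _ ih =>
    intro a
    simpa [mul_assoc] using ih (a * b)

lemma quadForm_mem {f : Fin n → R} {U : Matrix (Fin n) (Fin n) R} (hU : Matrix.vecMul f U = 0) :
    quadForm U ∈ lowDegreePart (reesKer f) 1 := by
  rw [quadForm, Finset.sum_comm, lowDegreePart_one_eq]
  refine Ideal.sum_mem _ fun j _ => ?_
  rw [← Finset.sum_mul]
  refine Ideal.mul_mem_right _ _ (Ideal.subset_span ?_)
  have hh : (∑ i, MvPolynomial.C (U i j) * MvPolynomial.X i :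
      MvPolynomial (Fin n) R).IsHomogeneous 1 :=
    MvPolynomial.IsHomogeneous.sum _ _ _ fun i _ => (MvPolynomial.isHomogeneous_X _ i).C_mul _
  refine ⟨(mem_reesKer_of_isHomogeneous hh).2 ?_, hh⟩
  have := congrFun hU j
  simp only [Matrix.vecMul, dotProduct, Pi.zero_apply] at this
  simpa [mul_comm] using this

/-- The strictly upper triangular part of a matrix. -/
def strictUpper {ι : Type*} [LinearOrder ι] (S : Matrix ι ι R) : Matrix ι ι R :=
  Matrix.of fun i j => if i < j then S i j else 0

lemma eq_strictUpper_sub_transpose {ι : Type*} [Fintype ι] [LinearOrder ι] {S : Matrix ι ι R}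
    (hS : ∀ v, v ⬝ᵥ S.mulVec v = 0) : S = strictUpper S - (strictUpper S).transpose := by
  have h1 : ∀ i, S i i = 0 := fun i => by simpa using hS (Pi.single i 1)
  have h2 : ∀ i j, S i j = - S j i := by
    intro i j
    have := hS (Pi.single i 1 + Pi.single j 1)
    simp [Matrix.mulVec_add, h1] at this
    exact eq_neg_of_add_eq_zero_left (by rw [← this]; ring)
  ext i j
  simp only [strictUpper, Matrix.sub_apply, Matrix.transpose_apply, Matrix.of_apply]
  rcases lt_trichotomy i j with h | rfl | h
  · simp [h, h.not_gt]
  · simp [h1]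
  · simp [h, h.not_gt, h2 i j]

end QuadraticForms

section Koszul

variable {R : Type*} [CommRing R]

/-- `x, y, z` is a weakly regular sequence. -/
structure RegularTriple (x y z : R) : Prop where
  fst : ∀ u, x * u = 0 → u = 0
  snd : ∀ u v, y * u = x * v → ∃ w, u = x * w
  trd : ∀ u v w, z * u = x * v + y * w → ∃ v' w', u = x * v' + y * w'

lemma RegularFamily.regularTriple {f : Fin 3 → R} (hf : RegularFamily f) :
    RegularTriple (f 2) (f 1) (f 0) := by
  obtain ⟨⟨⟨-, h2⟩, h1⟩, h0⟩ := hf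
  have e2 : Ideal.span (Set.range (Fin.tail (Fin.tail f))) = Ideal.span {f 2} := by
    rw [Set.range_unique]
    rfl
  have e1 : Ideal.span (Set.range (Fin.tail f)) = Ideal.span {f 1, f 2} := by
    congr 1
    ext w
    simp [Fin.tail, eq_comm]
  rw [e2] at h1
  rw [e1] at h0
  refine ⟨fun u hu => ?_, fun u v huv => ?_, fun u v w h => ?_⟩
  · have := h2 u
    simp only [Set.range_eq_empty, Ideal.span_empty, Ideal.mem_bot] at this
    exact this hu
  · obtain ⟨w, hw⟩ := Ideal.mem_span_singleton'.1 (h1 u (Ideal.mem_span_singleton'.2 ⟨v, by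
      rw [mul_comm, ← huv]; rfl⟩))
    exact ⟨w, by rw [← hw, mul_comm]⟩
  · obtain ⟨a, b, hab⟩ := Ideal.mem_span_pair.1 (h0 u (Ideal.mem_span_pair.2 ⟨w, v, by
      rw [h]; ring⟩))
    exact ⟨b, a, by rw [← hab]; ring⟩

variable {x y z : R}

lemma RegularTriple.exists_koszul (h : RegularTriple x y z) {ι : Type*} {a b c : ι → R}
    (habc : x • a + y • b + z • c = 0) :
    ∃ α β γ : ι → R, a = y • γ - z • β ∧ b = z • α - x • γ ∧ c = x • β - y • α := by
  have key : ∀ i, ∃ α β γ : R, a i = y * γ - z * β ∧ b i = z * α - x * γ ∧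
      c i = x * β - y * α := by
    intro i
    have hi : x * a i + y * b i + z * c i = 0 := by simpa using congrFun habc i
    obtain ⟨β, α, hc⟩ := h.trd (c i) (-a i) (-b i) (by linear_combination hi)
    obtain ⟨γ, hb⟩ := h.snd (b i + z * α) (-(a i + z * β)) (by
      linear_combination hi - z * hc)
    refine ⟨-α, β, -γ, ?_, by linear_combination hb, by linear_combination hc⟩
    have := h.fst (a i + z * β + y * γ) (by linear_combination hi - z * hc - y * hb)
    linear_combination this
  choose α β γ h1 h2 h3 using key
  exact ⟨α, β, γ, funext h1, funext h2, funext h3⟩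

lemma RegularTriple.exists_scalar (h : RegularTriple x y z) {α β γ : R}
    (_ : y * γ = z * β) (h2 : z * α = x * γ) (h3 : x * β = y * α) :
    ∃ s, α = x * s ∧ β = y * s ∧ γ = z * s := by
  obtain ⟨s, rfl⟩ := h.snd α β h3.symm
  refine ⟨s, rfl, ?_, ?_⟩
  · have := h.fst (β - y * s) (by linear_combination h3)
    linear_combination this
  · have := h.fst (γ - z * s) (by linear_combination -h2)
    linear_combination this

/-- First Koszul homology of the syzygies of `f` vanishes, if no element outside `(f)` is
multiplied into `(f)` by all of `x, y, z`. -/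
lemma RegularTriple.exists_koszul_syzygies (h : RegularTriple x y z) {n : ℕ}
    {f : Fin n → R}
    (hJ : ∀ s, s * x ∈ Ideal.span (Set.range f) → s * y ∈ Ideal.span (Set.range f) →
      s * z ∈ Ideal.span (Set.range f) → s ∈ Ideal.span (Set.range f))
    {a b c : Fin n → R} (ha : f ⬝ᵥ a = 0) (hb : f ⬝ᵥ b = 0) (hc : f ⬝ᵥ c = 0)
    (habc : x • a + y • b + z • c = 0) :
    ∃ α β γ : Fin n → R, f ⬝ᵥ α = 0 ∧ f ⬝ᵥ β = 0 ∧ f ⬝ᵥ γ = 0 ∧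
      a = y • γ - z • β ∧ b = z • α - x • γ ∧ c = x • β - y • α := by
  obtain ⟨α, β, γ, rfl, rfl, rfl⟩ := h.exists_koszul habc
  simp only [dotProduct_sub, dotProduct_smul, smul_eq_mul, sub_eq_zero] at ha hb hc
  obtain ⟨s, h1, h2, h3⟩ := h.exists_scalar ha hb hc
  have hmem : ∀ v : Fin n → R, f ⬝ᵥ v ∈ Ideal.span (Set.range f) := fun v =>
    Ideal.sum_mem _ fun i _ => Ideal.mul_mem_right _ _ (Ideal.subset_span ⟨i, rfl⟩)
  obtain ⟨σ, hσ⟩ := Ideal.mem_span_range_iff_exists_fun.1 (hJ s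
    (by rw [mul_comm, ← h1]; exact hmem α) (by rw [mul_comm, ← h2]; exact hmem β)
    (by rw [mul_comm, ← h3]; exact hmem γ))
  have hσ' : f ⬝ᵥ σ = s := by rw [dotProduct_comm]; exact hσ
  refine ⟨α - x • σ, β - y • σ, γ - z • σ, ?_, ?_, ?_, ?_, ?_, ?_⟩
  · rw [dotProduct_sub, dotProduct_smul, hσ', h1, smul_eq_mul, sub_self]
  · rw [dotProduct_sub, dotProduct_smul, hσ', h2, smul_eq_mul, sub_self]
  · rw [dotProduct_sub, dotProduct_smul, hσ', h3, smul_eq_mul, sub_self]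
  all_goals
    simp only [smul_sub, smul_smul, mul_comm z, mul_comm y x]
    abel

end Koszul

section SyzygyBasis

variable {R : Type*} [CommRing R]

/-- If the maximal ideal `m` is generated by a regular triple and `((f) : m) = (f)`, then the
syzygies of `f` are free in a neighbourhood of `m`. -/
lemma RegularTriple.exists_syzygy_basis [IsDomain R] [IsNoetherianRing R] {x y z : R}
    (h : RegularTriple x y z) {m : Ideal R} [hm : m.IsMaximal] (hxyz : m = Ideal.span {x, y, z})
    {n : ℕ} {f : Fin n → R}
    (hJ : ∀ s, s * x ∈ Ideal.span (Set.range f) → s * y ∈ Ideal.span (Set.range f) →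
      s * z ∈ Ideal.span (Set.range f) → s ∈ Ideal.span (Set.range f)) :
    ∃ (r : ℕ) (b : Fin r → Fin n → R) (s : R), s ∉ m ∧ (∀ i, f ⬝ᵥ b i = 0) ∧
      (∀ c : Fin r → R, ∑ i, c i • b i = 0 → c = 0) ∧
      ∀ v, f ⬝ᵥ v = 0 → ∃ c : Fin r → R, s • v = ∑ i, c i • b i := by
  classical
  let P : ℕ → Prop := fun r => ∃ (b : Fin r → Fin n → R) (s : R), s ∉ m ∧ (∀ i, f ⬝ᵥ b i = 0) ∧
    ∀ v, f ⬝ᵥ v = 0 → ∃ c : Fin r → R, s • v = ∑ i, c i • b i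
  have hP : ∃ r, P r := by
    let Z : Submodule R (Fin n → R) := LinearMap.ker (dotProductBilin R R f)
    obtain ⟨r, b, hb⟩ := (Submodule.fg_iff_exists_fin_generating_family (N := Z)).1
      (IsNoetherian.noetherian Z)
    have hbZ : ∀ v, v ∈ Submodule.span R (Set.range b) ↔ f ⬝ᵥ v = 0 := by
      intro v
      rw [hb]
      rfl
    refine ⟨r, b, 1, m.one_notMem, fun i => (hbZ _).1 (Submodule.subset_span ⟨i, rfl⟩), ?_⟩
    intro v hv
    obtain ⟨c, hc⟩ := (Submodule.mem_span_range_iff_exists_fun R).1 ((hbZ v).2 hv)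
    exact ⟨c, by rw [one_smul, hc]⟩
  obtain ⟨b, s, hs, hb, hbs⟩ := Nat.find_spec hP
  have hmin : ∀ r < Nat.find hP, ¬ P r := fun r hr => Nat.find_min hP hr
  generalize Nat.find hP = r at b hb hbs hmin
  refine ⟨r, b, s, hs, hb, ?_, hbs⟩
  have hcoef : ∀ c : Fin r → R, ∑ i, c i • b i = 0 → ∀ j, c j ∈ m := by
    intro c hc j
    by_contra hj
    obtain _ | r := r
    · exact j.elim0
    refine hmin r r.lt_succ_self ⟨b ∘ j.succAbove, c j * s, ?_, fun i => hb _, fun v hv => ?_⟩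
    · exact fun hmem => (hm.isPrime.mem_or_mem hmem).elim hj hs
    · obtain ⟨e, he⟩ := hbs v hv
      refine ⟨fun i => c j * e (j.succAbove i) - e j * c (j.succAbove i), ?_⟩
      rw [Fin.sum_univ_succAbove _ j] at hc he
      simp only [Function.comp, sub_smul, Finset.sum_sub_distrib, mul_smul, ← Finset.smul_sum]
      rw [he, eq_neg_of_add_eq_zero_right hc, smul_add, smul_neg, sub_neg_eq_add, smul_smul,
        smul_smul, mul_comm (e j), add_comm]
  let N : Submodule R (Fin r → R) := LinearMap.ker (Fintype.linearCombination R b)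
  have hN : ∀ c, c ∈ N ↔ ∑ i, c i • b i = 0 := fun c => by
    rw [LinearMap.mem_ker, Fintype.linearCombination_apply]
  have hsyz : ∀ c : Fin r → R, f ⬝ᵥ ∑ i, c i • b i = 0 := by
    intro c
    rw [dotProduct_sum]
    exact Finset.sum_eq_zero fun i _ => by rw [dotProduct_smul, hb, smul_zero]
  have hsN : ∀ c ∈ N, s • c ∈ m • N := by
    intro c hc
    have hc' := hcoef c ((hN c).1 hc)
    have : ∀ i, ∃ u v w, c i = x * u + y * v + z * w := by
      intro i
      have := hc' i
      rw [hxyz, Ideal.mem_span_insert] at this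
      obtain ⟨u, w, hw, hu⟩ := this
      obtain ⟨v, w', rfl⟩ := Ideal.mem_span_pair.1 hw
      exact ⟨u, v, w', by rw [hu]; ring⟩
    choose a₁ a₂ a₃ ha using this
    have hrel : x • (∑ i, a₁ i • b i) + y • (∑ i, a₂ i • b i) + z • (∑ i, a₃ i • b i) = 0 := by
      rw [← (hN c).1 hc]
      simp only [Finset.smul_sum, ← Finset.sum_add_distrib, smul_smul, ← add_smul, ha]
    obtain ⟨α, β, γ, hα, hβ, hγ, h1, h2, h3⟩ :=
      h.exists_koszul_syzygies hJ (hsyz a₁) (hsyz a₂) (hsyz a₃) hrel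
    obtain ⟨α', hα'⟩ := hbs α hα
    obtain ⟨β', hβ'⟩ := hbs β hβ
    obtain ⟨γ', hγ'⟩ := hbs γ hγ
    have hmem : ∀ (a u v : Fin r → R) (μ ν : R) (u' v' : Fin n → R),
        s • u' = ∑ i, u i • b i → s • v' = ∑ i, v i • b i →
        ∑ i, a i • b i = μ • u' - ν • v' → s • a - (μ • u - ν • v) ∈ N := by
      intro a u v μ ν u' v' hu hv hauv
      rw [hN]
      simp only [Pi.sub_apply, Pi.smul_apply, smul_eq_mul, sub_smul, mul_smul,
        Finset.sum_sub_distrib, ← Finset.smul_sum, hauv, ← hu, ← hv]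
      rw [smul_sub, smul_comm s μ, smul_comm s ν, sub_self]
    have hx : x ∈ m := hxyz ▸ Ideal.subset_span (by simp)
    have hy : y ∈ m := hxyz ▸ Ideal.subset_span (by simp)
    have hz : z ∈ m := hxyz ▸ Ideal.subset_span (by simp)
    have := add_mem (add_mem (Submodule.smul_mem_smul hx (hmem _ _ _ _ _ _ _ hγ' hβ' h1))
      (Submodule.smul_mem_smul hy (hmem _ _ _ _ _ _ _ hα' hγ' h2)))
      (Submodule.smul_mem_smul hz (hmem _ _ _ _ _ _ _ hβ' hα' h3))
    convert this using 1
    ext i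
    simp only [Pi.smul_apply, Pi.add_apply, Pi.sub_apply, smul_eq_mul, ha]
    ring
  have hle : N ≤ m • N := by
    intro c hc
    obtain ⟨t, ht⟩ := hm.exists_inv hs
    obtain ⟨μ, hμ, hμt⟩ := ht
    have : c = t • s • c + μ • c := by
      rw [smul_smul, ← add_smul, hμt, one_smul]
    rw [this]
    exact add_mem (Submodule.smul_mem _ _ (hsN c hc)) (Submodule.smul_mem_smul hμ hc)
  obtain ⟨t, ht, htN⟩ := Submodule.exists_sub_one_mem_and_smul_eq_zero_of_fg_of_le_smul m N
    (IsNoetherian.noetherian N) hle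
  have ht0 : t ≠ 0 := by
    rintro rfl
    exact m.one_notMem (by simpa using ht)
  intro c hc
  exact (smul_eq_zero.1 (htN c ((hN c).2 hc))).resolve_left ht0

/-- An injective matrix over a domain has a left inverse up to a nonzero scalar. -/
lemma exists_mul_eq_smul_one [IsDomain R] {n r : ℕ} (B : Matrix (Fin n) (Fin r) R)
    (hB : ∀ c, B.mulVec c = 0 → c = 0) :
    ∃ (D : Matrix (Fin r) (Fin n) R) (d : R), d ≠ 0 ∧ D * B = d • 1 := by
  let K := FractionRing R
  let B' : Matrix (Fin n) (Fin r) K := B.map (algebraMap R K)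
  have hinj : Function.Injective (Matrix.toLin' B') := by
    rw [← LinearMap.ker_eq_bot, LinearMap.ker_eq_bot']
    intro v hv
    obtain ⟨⟨d, hd⟩, hdv⟩ := IsLocalization.exist_integer_multiples (nonZeroDivisors R)
      Finset.univ v
    choose c hc using fun i => hdv i (Finset.mem_univ i)
    have hc0 : c = 0 := by
      refine hB c (funext fun i => IsFractionRing.injective R K ?_)
      have := congrFun hv i
      simp only [Matrix.toLin'_apply, Matrix.mulVec, dotProduct, Pi.zero_apply] at this ⊢
      rw [map_sum, map_zero]
      simp only [map_mul, hc]
      rw [← smul_zero d, ← this, Finset.smul_sum]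
      exact Finset.sum_congr rfl fun j _ => by simp [B']
    ext i
    have := hc i
    rw [hc0, Pi.zero_apply, map_zero, Algebra.smul_def] at this
    exact (mul_eq_zero.1 this.symm).resolve_left
      (IsLocalization.to_map_ne_zero_of_mem_nonZeroDivisors K le_rfl hd)
  obtain ⟨g, hg⟩ := LinearMap.exists_leftInverse_of_injective _ (LinearMap.ker_eq_bot.2 hinj)
  obtain ⟨G, hG⟩ : ∃ G : Matrix (Fin r) (Fin n) K, G * B' = 1 := by
    refine ⟨LinearMap.toMatrix' g, ?_⟩
    rw [← LinearMap.toMatrix'_toLin' B', ← LinearMap.toMatrix'_comp, hg, LinearMap.toMatrix'_id]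
  obtain ⟨⟨d, hd⟩, hdv⟩ := IsLocalization.exist_integer_multiples (nonZeroDivisors R)
    Finset.univ fun p : Fin r × Fin n => G p.1 p.2
  choose D hD using fun p => hdv p (Finset.mem_univ p)
  refine ⟨Matrix.of fun i j => D (i, j), d, nonZeroDivisors.ne_zero hd, ?_⟩
  ext i j
  apply IsFractionRing.injective R K
  have hij := congrArg (algebraMap R K d * ·) (congrFun (congrFun hG i) j)
  simp only [Matrix.mul_apply] at hij
  simp only [Matrix.mul_apply, map_sum, map_mul, Matrix.of_apply, hD, Matrix.smul_apply,
    smul_eq_mul, Algebra.smul_def, mul_assoc, ← Finset.mul_sum]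
  refine hij.trans ?_
  rcases eq_or_ne i j with rfl | hne
  · simp
  · simp [Matrix.one_apply_ne hne]

end SyzygyBasis

section KeyLemma

variable {R : Type*} [CommRing R]

lemma quadForm_congr_sub_transpose {n r : ℕ} (B : Matrix (Fin n) (Fin r) R)
    (M : Matrix (Fin r) (Fin r) R) : quadForm (B * (M - M.transpose) * B.transpose) = 0 := by
  rw [Matrix.mul_sub, Matrix.sub_mul, quadForm_sub, sub_eq_zero,
    ← quadForm_transpose (B * M * B.transpose)]
  simp only [Matrix.transpose_mul, Matrix.transpose_transpose, Matrix.mul_assoc]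

/-- An alternating matrix killed by `f` is, up to a scalar, of the form `B S Bᵀ` with `S`
alternating, where `B` is a matrix of linearly independent syzygies of `f`. -/
lemma exists_alternating_congr [IsDomain R] {n r : ℕ} {f : Fin n → R}
    {B : Matrix (Fin n) (Fin r) R} {s : R} (hB : ∀ c, B.mulVec c = 0 → c = 0)
    (hs : ∀ v, f ⬝ᵥ v = 0 → ∃ c, s • v = B.mulVec c)
    {A : Matrix (Fin n) (Fin n) R} (hA : quadForm A = 0) (hfA : Matrix.vecMul f A = 0) :
    ∃ S : Matrix (Fin r) (Fin r) R, s ^ 2 • A = B * S * B.transpose ∧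
      ∀ v, v ⬝ᵥ S.mulVec v = 0 := by
  have halt : ∀ v, v ⬝ᵥ A.mulVec v = 0 := fun v => by rw [← eval_quadForm, hA, map_zero]
  have hskew : A.transpose = - A := by
    rw [eq_strictUpper_sub_transpose halt, Matrix.transpose_sub, Matrix.transpose_transpose,
      neg_sub]
  have hmul : ∀ {l : ℕ} (M : Matrix (Fin r) (Fin l) R), B * M = 0 → M = 0 := by
    intro l M hM
    ext i j
    exact congrFun (hB (fun i => M i j) (funext fun i => congrFun (congrFun hM i) j)) i
  have hlift : ∀ {l : ℕ} (M : Matrix (Fin n) (Fin l) R), Matrix.vecMul f M = 0 →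
      ∃ C : Matrix (Fin r) (Fin l) R, s • M = B * C := by
    intro l M hM
    choose C hC using fun j => hs (fun i => M i j) (congrFun hM j)
    refine ⟨Matrix.of fun i j => C j i, ?_⟩
    ext i j
    exact congrFun (hC j) i
  obtain ⟨C, hC⟩ := hlift A hfA
  have hAf : A.mulVec f = 0 := by
    rw [← Matrix.vecMul_transpose, hskew, Matrix.vecMul_neg, hfA, neg_zero]
  have hCf : Matrix.vecMul f C.transpose = 0 := by
    rw [Matrix.vecMul_transpose]
    apply hB
    rw [Matrix.mulVec_mulVec, ← hC, Matrix.smul_mulVec, hAf, smul_zero]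
  obtain ⟨S, hS⟩ := hlift C.transpose hCf
  have hS' : s • C = S.transpose * B.transpose := by
    rw [← Matrix.transpose_mul, ← hS, Matrix.transpose_smul, Matrix.transpose_transpose]
  have hASB : s ^ 2 • A = B * S.transpose * B.transpose := by
    rw [sq, mul_smul, hC, ← Matrix.mul_smul, hS', Matrix.mul_assoc]
  refine ⟨S.transpose, hASB, fun v => ?_⟩
  obtain ⟨D, d, hd, hDB⟩ := exists_mul_eq_smul_one B hB
  have hv : B.transpose.mulVec (D.transpose.mulVec v) = d • v := by
    rw [Matrix.mulVec_mulVec, ← Matrix.transpose_mul, hDB, Matrix.transpose_smul,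
      Matrix.transpose_one, Matrix.smul_mulVec, Matrix.one_mulVec]
  have key : (D.transpose.mulVec v) ⬝ᵥ (s ^ 2 • A).mulVec (D.transpose.mulVec v) =
      d * (d * (v ⬝ᵥ S.transpose.mulVec v)) := by
    rw [hASB, ← Matrix.mulVec_mulVec, ← Matrix.mulVec_mulVec, hv, Matrix.dotProduct_mulVec,
      ← Matrix.mulVec_transpose, hv, Matrix.mulVec_smul, smul_dotProduct, dotProduct_smul,
      smul_eq_mul, smul_eq_mul]
  rw [Matrix.smul_mulVec, dotProduct_smul, halt, smul_zero] at key
  simpa [hd] using key.symm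

lemma RegularTriple.mem_lowDegreePart [IsDomain R] [IsNoetherianRing R] {x y z : R}
    (h : RegularTriple x y z) {m : Ideal R} [hm : m.IsMaximal] (hxyz : m = Ideal.span {x, y, z})
    {n : ℕ} {f : Fin n → R}
    (hJ : ∀ s, s * x ∈ Ideal.span (Set.range f) → s * y ∈ Ideal.span (Set.range f) →
      s * z ∈ Ideal.span (Set.range f) → s ∈ Ideal.span (Set.range f))
    {p : MvPolynomial (Fin n) R} (hp : p.IsHomogeneous 2)
    (hmp : ∀ a ∈ m, MvPolynomial.C a * p ∈ lowDegreePart (reesKer f) 1) :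
    p ∈ lowDegreePart (reesKer f) 1 := by
  have hx : x ∈ m := hxyz ▸ Ideal.subset_span (by simp)
  have hy : y ∈ m := hxyz ▸ Ideal.subset_span (by simp)
  have hz : z ∈ m := hxyz ▸ Ideal.subset_span (by simp)
  obtain ⟨r, b, s, hs, hfb, hb, hbs⟩ := h.exists_syzygy_basis hxyz hJ
  let B : Matrix (Fin n) (Fin r) R := Matrix.of fun i j => b j i
  have hBmul : ∀ c, B.mulVec c = ∑ j, c j • b j := by
    intro c
    ext i
    simp [Matrix.mulVec, dotProduct, B, mul_comm]
  have hB : ∀ c, B.mulVec c = 0 → c = 0 := fun c hc => hb c (by rw [← hBmul, hc])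
  have hfB : Matrix.vecMul f B = 0 := funext hfb
  have hBs : ∀ v, f ⬝ᵥ v = 0 → ∃ c, s • v = B.mulVec c := by
    simpa only [hBmul] using hbs
  have hBB : ∀ S : Matrix (Fin r) (Fin r) R, B * S * B.transpose = 0 → S = 0 := by
    intro S hS
    obtain ⟨D, d, hd, hDB⟩ := exists_mul_eq_smul_one B hB
    have : D * (B * S * B.transpose) * D.transpose = (d * d) • S := by
      calc _ = (D * B) * S * (D * B).transpose := by
            simp only [Matrix.transpose_mul, Matrix.mul_assoc]
        _ = _ := by simp [hDB, smul_smul]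
    rw [hS, Matrix.mul_zero, Matrix.zero_mul] at this
    exact (smul_eq_zero.1 this.symm).resolve_left (mul_ne_zero hd hd)
  obtain ⟨U, hU, hxU⟩ := exists_quadForm_of_mem (hp.C_mul x) (hmp x hx)
  obtain ⟨V, hV, hyV⟩ := exists_quadForm_of_mem (hp.C_mul y) (hmp y hy)
  obtain ⟨W, hW, hzW⟩ := exists_quadForm_of_mem (hp.C_mul z) (hmp z hz)
  have hcong : ∀ {μ ν : R} {E F : Matrix (Fin n) (Fin n) R}, Matrix.vecMul f E = 0 →
      Matrix.vecMul f F = 0 → MvPolynomial.C ν * p = quadForm E →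
      MvPolynomial.C μ * p = quadForm F →
      ∃ S : Matrix (Fin r) (Fin r) R, s ^ 2 • (μ • E - ν • F) = B * S * B.transpose ∧
        ∀ v, v ⬝ᵥ S.mulVec v = 0 := by
    intro μ ν E F hE hF hqE hqF
    refine exists_alternating_congr hB hBs ?_ ?_
    · rw [quadForm_sub, quadForm_smul, quadForm_smul, ← hqE, ← hqF]
      ring
    · rw [Matrix.vecMul_sub, Matrix.vecMul_smul, Matrix.vecMul_smul, hE, hF, smul_zero, smul_zero,
        sub_zero]
  obtain ⟨S₁, hS₁, -⟩ := hcong hV hW hyV hzW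
  obtain ⟨S₂, hS₂, -⟩ := hcong hW hU hzW hxU
  obtain ⟨S₃, hS₃, hS₃'⟩ := hcong hU hV hxU hyV
  have hrel : x • S₁ + y • S₂ + z • S₃ = 0 := by
    apply hBB
    simp only [Matrix.mul_add, Matrix.add_mul, Matrix.mul_smul, Matrix.smul_mul, ← hS₁, ← hS₂,
      ← hS₃]
    ext i j
    simp only [Matrix.add_apply, Matrix.smul_apply, Matrix.sub_apply, smul_eq_mul,
      Matrix.zero_apply]
    ring
  have hS : ∀ i j, ∃ v w, S₃ i j = x * v + y * w := by
    intro i j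
    have := congrFun (congrFun hrel i) j
    simp only [Matrix.add_apply, Matrix.smul_apply, smul_eq_mul, Matrix.zero_apply] at this
    exact h.trd (S₃ i j) (-S₁ i j) (-S₂ i j) (by linear_combination this)
  choose β α hβα using hS
  let β' : Matrix (Fin r) (Fin r) R := strictUpper (Matrix.of β)
  let α' : Matrix (Fin r) (Fin r) R := strictUpper (Matrix.of α)
  have hupper : strictUpper S₃ = x • β' + y • α' := by
    ext i j
    simp only [strictUpper, β', α', Matrix.add_apply, Matrix.smul_apply, Matrix.of_apply, hβα,
      smul_eq_mul]
    split_ifs <;> simp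
  have hS₃β : s ^ 2 • (y • U - x • V) = x • (B * (β' - β'.transpose) * B.transpose) +
      y • (B * (α' - α'.transpose) * B.transpose) := by
    have hsub : S₃ = x • (β' - β'.transpose) + y • (α' - α'.transpose) := by
      rw [eq_strictUpper_sub_transpose hS₃', hupper]
      simp only [Matrix.transpose_add, Matrix.transpose_smul, smul_sub]
      abel
    rw [hS₃, hsub, Matrix.mul_add, Matrix.add_mul, Matrix.mul_smul, Matrix.smul_mul,
      Matrix.mul_smul, Matrix.smul_mul]
  have hdiv : ∀ i j, ∃ w, (s ^ 2 • U - B * (α' - α'.transpose) * B.transpose) i j = x * w := by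
    intro i j
    refine h.snd _ ((s ^ 2 • V + B * (β' - β'.transpose) * B.transpose) i j) ?_
    have := congrFun (congrFun hS₃β i) j
    simp only [Matrix.add_apply, Matrix.smul_apply, Matrix.sub_apply, smul_eq_mul] at this ⊢
    linear_combination this
  choose U' hU' using hdiv
  have hU'' : s ^ 2 • U - B * (α' - α'.transpose) * B.transpose = x • Matrix.of U' :=
    Matrix.ext hU'
  have hC : ∀ q : MvPolynomial (Fin n) R, MvPolynomial.C x * q = 0 → q = 0 := by
    intro q hq
    ext d
    exact h.fst _ (by simpa using congrArg (MvPolynomial.coeff d) hq)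
  have hfU' : Matrix.vecMul f (Matrix.of U') = 0 := by
    have := congrArg (Matrix.vecMul f) hU''
    rw [Matrix.vecMul_sub, Matrix.vecMul_smul, hU, Matrix.mul_assoc, ← Matrix.vecMul_vecMul, hfB,
      Matrix.zero_vecMul, smul_zero, sub_zero, Matrix.vecMul_smul] at this
    ext i
    exact h.fst _ (congrFun this.symm i)
  have hsp : MvPolynomial.C (s ^ 2) * p = quadForm (Matrix.of U') := by
    rw [← sub_eq_zero]
    apply hC
    rw [mul_sub, ← quadForm_smul x, ← hU'', quadForm_sub, quadForm_congr_sub_transpose,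
      quadForm_smul, ← hxU]
    ring
  have hs2 : s ^ 2 ∉ m := fun hmem => hs (hm.isPrime.mem_of_pow_mem 2 hmem)
  obtain ⟨t, μ, hμ, hμt⟩ := hm.exists_inv hs2
  have : p = MvPolynomial.C t * (MvPolynomial.C (s ^ 2) * p) + MvPolynomial.C μ * p := by
    rw [← mul_assoc, ← map_mul, ← add_mul, ← map_add, hμt, map_one, one_mul]
  rw [this]
  refine add_mem (Ideal.mul_mem_left _ _ ?_) (hmp μ hμ)
  rw [hsp]
  exact quadForm_mem hfU'

end KeyLemma

section HeightTwo

variable {R : Type*} [CommRing R]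

lemma idealHeight_eq_height (P : Ideal R) [hP : P.IsPrime] : idealHeight P = P.height := by
  refine le_antisymm ?_ (le_iInf fun Q => ?_)
  · rw [show P.height = Order.height (⟨P, hP⟩ : PrimeSpectrum R) from
      PrimeSpectrum.height_eq_orderHeight ⟨P, hP⟩]
    exact iInf_le (fun Q : {Q : PrimeSpectrum R // P ≤ Q.asIdeal} => Order.height Q.1)
      ⟨⟨P, hP⟩, le_rfl⟩
  · rw [← PrimeSpectrum.height_eq_orderHeight]
    exact Ideal.height_mono Q.2

lemma MaximalIdealsRegular.height_lt {n : ℕ} (h : MaximalIdealsRegular R (n + 1)) {P : Ideal R}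
    [hP : P.IsPrime] (hmax : ¬ P.IsMaximal) : P.height < (n + 1 : ℕ) := by
  obtain ⟨m, hm, hPm⟩ := Ideal.exists_le_maximal P hP.ne_top
  have hlt : P < m := lt_of_le_of_ne hPm fun heq => hmax (heq ▸ hm)
  have := hm.isPrime
  have h1 := Ideal.height_add_one_le_of_lt_of_isPrime hlt
  rw [(h m hm).1] at h1
  exact (ENat.add_one_le_iff (fun htop => by simp [htop] at h1)).1 h1

/-- Prime avoidance for finitely many primes not contained in `Q`. -/
lemma exists_notMem_forall_mem {Q : Ideal R} (hQ : Q.IsPrime) {F : Set (Ideal R)} (hF : F.Finite)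
    (h : ∀ P ∈ F, ¬ P ≤ Q) : ∃ t ∉ Q, ∀ P ∈ F, t ∈ P := by
  have : ¬ (hF.toFinset.inf id ≤ Q) := by
    rw [hQ.inf_le']
    rintro ⟨P, hP, hPQ⟩
    exact h P (hF.mem_toFinset.1 hP) hPQ
  obtain ⟨t, ht, htQ⟩ := SetLike.not_le_iff_exists.1 this
  exact ⟨t, htQ, fun P hP => (Finset.inf_le (f := id) (hF.mem_toFinset.2 hP)) ht⟩

lemma exists_notMem_forall_mul_mem_span {Q : Ideal R} [hQ : Q.IsPrime] [IsNoetherianRing R]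
    {J : Ideal R} (h : ∀ q ∈ Q, ∃ s ∉ Q, s * q ∈ J) : ∃ s ∉ Q, ∀ q ∈ Q, s * q ∈ J := by
  obtain ⟨r, e, he⟩ := exists_fin_span_eq Q
  choose s hs hsJ using fun i => h (e i) (he ▸ Ideal.subset_span ⟨i, rfl⟩)
  refine ⟨∏ i, s i, fun hmem => ?_, fun q hq => ?_⟩
  · obtain ⟨i, -, hi⟩ := hQ.prod_mem_iff.1 hmem
    exact hs i hi
  · rw [← he] at hq
    obtain ⟨c, rfl⟩ := Ideal.mem_span_range_iff_exists_fun.1 hq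
    rw [Finset.mul_sum]
    refine Ideal.sum_mem _ fun i _ => ?_
    rw [← Finset.mul_prod_erase _ _ (Finset.mem_univ i)]
    have := Ideal.mul_mem_left J (c i * ∏ j ∈ Finset.univ.erase i, s j) (hsJ i)
    convert this using 1
    ring

/-- A height two prime of a regular ring is generated by two elements at its generic point. -/
lemma exists_pair_of_height_eq_two [IsRegularRing R] {Q : Ideal R} [hQ : Q.IsPrime]
    (hQ2 : Q.height = 2) : ∃ g ∈ Q, ∃ h ∈ Q, ∃ s ∉ Q, ∀ q ∈ Q, s * q ∈ Ideal.span {g, h} := by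
  classical
  let S := Localization.AtPrime Q
  have hreg := (isRegularLocalRing_iff S).1 inferInstance
  rw [IsLocalization.AtPrime.ringKrullDim_eq_height Q S, hQ2] at hreg
  obtain ⟨u, hu, hspan⟩ := (IsNoetherian.noetherian
    (IsLocalRing.maximalIdeal S)).exists_span_finset_card_eq_spanFinrank
  rw [← hu] at hreg
  have hcard : u.card = 2 := by exact_mod_cast hreg
  obtain ⟨a, b, -, rfl⟩ := Finset.card_eq_two.1 hcard
  have key : ∀ a ∈ IsLocalRing.maximalIdeal S, ∃ g ∈ Q, ∃ v : S, a = v * algebraMap R S g := by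
    intro a ha
    obtain ⟨⟨g, s⟩, rfl⟩ := IsLocalization.mk'_surjective Q.primeCompl a
    refine ⟨g, ?_, IsLocalization.mk' S 1 s, ?_⟩
    · exact (IsLocalization.AtPrime.mk'_mem_maximal_iff S Q g s).1 ha
    · rw [mul_comm, ← IsLocalization.mk'_eq_mul_mk'_one]
  obtain ⟨g, hg, v, hv⟩ := key a (hspan ▸ Submodule.subset_span (by simp))
  obtain ⟨h, hh, w, hw⟩ := key b (hspan ▸ Submodule.subset_span (by simp))
  refine ⟨g, hg, h, hh, exists_notMem_forall_mul_mem_span fun q hq => ?_⟩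
  have hqS : algebraMap R S q ∈ (Ideal.span {g, h}).map (algebraMap R S) := by
    have : algebraMap R S q ∈ IsLocalRing.maximalIdeal S :=
      (IsLocalization.AtPrime.to_map_mem_maximal_iff S Q q).2 hq
    rw [← hspan, Finset.coe_pair, Submodule.mem_span_pair] at this
    obtain ⟨c, d, hcd⟩ := this
    rw [Ideal.map_span, Set.image_pair, Ideal.mem_span_pair]
    exact ⟨c * v, d * w, by rw [← hcd, hv, hw]; simp only [smul_eq_mul]; ring⟩
  obtain ⟨⟨⟨j, hj⟩, s⟩, hs⟩ := (IsLocalization.mem_map_algebraMap_iff Q.primeCompl S).1 hqS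
  rw [← map_mul] at hs
  obtain ⟨t, ht⟩ := (IsLocalization.eq_iff_exists Q.primeCompl S).1 hs
  refine ⟨t * s, (t * s).2, ?_⟩
  rw [mul_assoc, mul_comm _ q]
  change t * (q * s) ∈ _
  rw [ht]
  exact Ideal.mul_mem_left _ _ hj

lemma exists_prime_dvd [IsDomain R] [UniqueFactorizationMonoid R] {Q : Ideal R} [hQ : Q.IsPrime]
    (hQ0 : Q ≠ ⊥) {g : R} (hg : g ∈ Q) : ∃ g' ∈ Q, Prime g' ∧ g' ∣ g := by
  by_cases hg0 : g = 0
  · obtain ⟨x, hx, hx'⟩ := hQ.exists_mem_prime_of_ne_bot hQ0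
    exact ⟨x, hx, hx', hg0 ▸ dvd_zero x⟩
  · obtain ⟨l, hl, hlg⟩ := UniqueFactorizationMonoid.exists_prime_factors g hg0
    have : l.prod ∈ Q := by
      obtain ⟨u, hu⟩ := hlg.symm
      exact hu ▸ Ideal.mul_mem_right _ _ hg
    obtain ⟨x, hx, hxQ⟩ := hQ.multiset_prod_mem_iff_exists_mem l |>.1 this
    exact ⟨x, hxQ, hl x hx, (Multiset.dvd_prod hx).trans hlg.dvd⟩

lemma regularFamily_singleton [IsDomain R] {g : R} (hg : g ≠ 0) : RegularFamily ![g] := by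
  refine ⟨trivial, fun u hu => ?_⟩
  rw [Set.range_eq_empty, Ideal.span_empty, Ideal.mem_bot] at hu ⊢
  exact (mul_eq_zero.1 hu).resolve_left hg

lemma regularFamily_pair [IsDomain R] {g h : R} (hg : Prime g) (hgh : ¬ g ∣ h) :
    RegularFamily ![h, g] := by
  refine ⟨regularFamily_singleton hg.ne_zero, fun u hu => ?_⟩
  have : Set.range (Fin.tail ![h, g]) = {g} := by
    ext w
    simp [eq_comm]
  rw [this, Ideal.mem_span_singleton] at hu ⊢
  exact (hg.dvd_or_dvd hu).resolve_left hgh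

/-- A height two prime of a regular factorial domain is generated by a regular sequence at its
generic point. -/
lemma exists_regularFamily_of_height_eq_two [IsDomain R] [UniqueFactorizationMonoid R]
    [IsRegularRing R] {Q : Ideal R} [hQ : Q.IsPrime] (hQ2 : Q.height = 2) :
    ∃ (n : ℕ) (e : Fin n → R), RegularFamily e ∧ (∀ i, e i ∈ Q) ∧
      ∃ s ∉ Q, ∀ q ∈ Q, s * q ∈ Ideal.span (Set.range e) := by
  have hQ0 : Q ≠ ⊥ := by
    rintro rfl
    simp at hQ2
  obtain ⟨g, hg, h, hh, s, hs, hsQ⟩ := exists_pair_of_height_eq_two hQ2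
  obtain ⟨g', hg', hgp, hgg⟩ := exists_prime_dvd hQ0 hg
  obtain ⟨h', hh', hhp, hhh⟩ := exists_prime_dvd hQ0 hh
  by_cases hdvd : g' ∣ h'
  · refine ⟨1, ![g'], regularFamily_singleton hgp.ne_zero, by simpa, s, hs, fun q hq => ?_⟩
    refine (Ideal.span_le.2 ?_ : Ideal.span {g, h} ≤ _) (hsQ q hq)
    simp only [Matrix.range_cons, Matrix.range_empty, Set.union_empty]
    rintro _ (rfl | rfl)
    · exact Ideal.mem_span_singleton.2 hgg
    · exact Ideal.mem_span_singleton.2 (hdvd.trans hhh)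
  · refine ⟨2, ![h', g'], regularFamily_pair hgp hdvd, by simp [Fin.forall_fin_two, *], s, hs,
      fun q hq => ?_⟩
    refine (Ideal.span_le.2 ?_ : Ideal.span {g, h} ≤ _) (hsQ q hq)
    rintro _ (rfl | rfl)
    · exact Ideal.mem_of_dvd _ hgg (Ideal.subset_span ⟨1, rfl⟩)
    · exact Ideal.mem_of_dvd _ hhh (Ideal.subset_span ⟨0, rfl⟩)

end HeightTwo

section HeightTwoUnmixed

variable {R : Type*} [CommRing R]

lemma genInDegLE_one : GenInDegLE (reesKer ![(1 : R)]) 1 := by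
  have h : RegularFamily ![(1 : R)] := ⟨trivial, fun u hu => by simpa using hu⟩
  exact h.linearTypeFamily.1

lemma span_range_one : Ideal.span (Set.range ![(1 : R)]) = ⊤ := by
  simp

/-- An intersection of finitely many height two primes in a three dimensional regular factorial
domain is syzygetic. -/
lemma syzygetic_sInf [IsDomain R] [UniqueFactorizationMonoid R] [IsRegularRing R]
    (hR : MaximalIdealsRegular R 3) {F : Set (Ideal R)} (hF : F.Finite)
    (hprime : ∀ P ∈ F, P.IsPrime) (hht : ∀ P ∈ F, P.height = 2) : Syzygetic (sInf F) := by
  have hnotmax : ∀ P ∈ F, ¬ P.IsMaximal := by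
    intro P hP hmax
    have h1 := hht P hP
    rw [(hR P hmax).1] at h1
    norm_num at h1
  have hmin : ∀ P ∈ F, ∀ Q : Ideal R, Q.IsPrime → ¬ Q.IsMaximal → P ≤ Q → P = Q := by
    intro P hP Q hQ hQmax hle
    have := hprime P hP
    by_contra hne
    have h1 := Ideal.height_add_one_le_of_lt_of_isPrime (lt_of_le_of_ne hle hne)
    rw [hht P hP] at h1
    have h2 := hR.height_lt hQmax
    exact absurd (h1.trans_lt h2) (by norm_num)
  intro n f hf p hp hh
  rw [← lowDegreePart_one_eq]
  by_contra hpT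
  let c : Ideal R := Ideal.comap MvPolynomial.C ((lowDegreePart (reesKer f) 1).colon {p})
  have hc : ∀ r, r ∈ c ↔ MvPolynomial.C r * p ∈ lowDegreePart (reesKer f) 1 := by
    intro r
    rw [Ideal.mem_comap, Submodule.mem_colon_singleton, smul_eq_mul]
  have hctop : c ≠ ⊤ := by
    rw [Ideal.ne_top_iff_one, hc]
    simpa using hpT
  have hlocal : ∀ Q : Ideal R, Q.IsPrime → ¬ Q.IsMaximal → ¬ c ≤ Q := by
    intro Q hQ hQmax hle
    have key : ∀ {t : ℕ} {g : Fin t → R} {a : R}, a ∉ Q →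
        (∀ i, a * f i ∈ Ideal.span (Set.range g)) → (∀ j, a * g j ∈ Ideal.span (Set.range f)) →
        ¬ GenInDegLE (reesKer g) 1 := by
      intro t g a ha hfg hgf hg
      have := hle ((hc _).2 (pow_mul_mem_lowDegreePart hfg hgf le_rfl hg hp hh))
      exact ha (hQ.mem_of_pow_mem 2 (hQ.mem_of_pow_mem 2 this))
    by_cases hJQ : sInf F ≤ Q
    · have hQF : Q ∈ F := by
        rw [← hF.coe_toFinset, ← Finset.inf_id_eq_sInf, hQ.inf_le'] at hJQ
        obtain ⟨P, hP, hPQ⟩ := hJQ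
        rw [hF.mem_toFinset] at hP
        exact hmin P hP Q hQ hQmax hPQ ▸ hP
      obtain ⟨t, e, he, heQ, s, hs, hsQ⟩ := exists_regularFamily_of_height_eq_two (hht Q hQF)
      obtain ⟨u, hu, huF⟩ := exists_notMem_forall_mem hQ (hF.subset (Set.sep_subset F (· ≠ Q)))
        fun P hP hPQ => hP.2 (hmin P hP.1 Q hQ hQmax hPQ)
      refine key (a := s * u) (fun hmem => (hQ.mem_or_mem hmem).elim hs hu) (fun i => ?_)
        (fun j => ?_) he.linearTypeFamily.1
      · have hfi : f i ∈ Q := by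
          have : f i ∈ sInf F := hf ▸ Ideal.subset_span ⟨i, rfl⟩
          exact Ideal.mem_sInf.1 this hQF
        rw [mul_right_comm]
        exact Ideal.mul_mem_right _ _ (hsQ _ hfi)
      · rw [hf, Ideal.mem_sInf]
        intro P hP
        by_cases hPQ : P = Q
        · exact hPQ ▸ Ideal.mul_mem_left _ _ (heQ j)
        · exact Ideal.mul_mem_right _ _ (Ideal.mul_mem_left _ _ (huF P ⟨hP, hPQ⟩))
    · obtain ⟨a, ha, haQ⟩ := SetLike.not_le_iff_exists.1 hJQ
      refine key haQ (fun i => ?_) (fun j => ?_) genInDegLE_one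
      · rw [span_range_one]
        trivial
      · rw [hf]
        exact Ideal.mul_mem_right _ _ ha
  have : Nontrivial (R ⧸ c) := Ideal.Quotient.nontrivial_iff.2 hctop
  obtain ⟨m, hm⟩ := associatedPrimes.nonempty R (R ⧸ c)
  obtain ⟨hmp, w, hw⟩ := (isAssociatedPrime_iff).1 hm
  obtain ⟨r, rfl⟩ := Ideal.Quotient.mk_surjective w
  have hmr : ∀ a, a ∈ m ↔ a * r ∈ c := by
    intro a
    rw [hw, Submodule.mem_colon_singleton, Submodule.mem_bot, ← Ideal.Quotient.eq_zero_iff_mem]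
    rfl
  have hr : r ∉ c := fun h => hmp.ne_top ((Ideal.eq_top_iff_one _).2 ((hmr 1).2 (by simpa)))
  have hmax : m.IsMaximal := by
    by_contra hmax
    exact hlocal m hmp hmax fun a ha => (hmr a).2 (Ideal.mul_mem_right _ _ ha)
  obtain ⟨-, e, he, hreg⟩ := hR m hmax
  have hme : m = Ideal.span {e 2, e 1, e 0} := by
    rw [← he]
    congr 1
    ext w
    simp only [Set.mem_range, Fin.exists_fin_succ, Set.mem_insert_iff, Set.mem_singleton_iff,
      eq_comm]
    simp
    tauto
  refine hr ((hc r).2 (hreg.regularTriple.mem_lowDegreePart hme ?_ (hh.C_mul r) fun a ha => ?_))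
  · intro s h2 h1 h0
    rw [hf, Ideal.mem_sInf] at h2 h1 h0 ⊢
    intro P hP
    by_contra hs
    have hPp := hprime P hP
    have hle : m ≤ P := by
      rw [hme, Ideal.span_le]
      rintro _ (rfl | rfl | rfl)
      · exact (hPp.mem_or_mem (h2 hP)).resolve_left hs
      · exact (hPp.mem_or_mem (h1 hP)).resolve_left hs
      · exact (hPp.mem_or_mem (h0 hP)).resolve_left hs
    exact hnotmax P hP (hmax.eq_of_le hPp.ne_top hle ▸ hmax)
  · rw [← mul_assoc, ← map_mul]
    exact (hc _).1 ((hmr a).1 ha)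

end HeightTwoUnmixed

section Assembly

variable {R : Type*} [CommRing R]

lemma relType_eq_of_forall_le_iff [IsNoetherianRing R] {I J : Ideal R}
    (h : ∀ N, 1 ≤ N → (relType I ≤ N ↔ relType J ≤ N)) : relType I = relType J :=
  le_antisymm ((h _ (one_le_relType J)).2 le_rfl) ((h _ (one_le_relType I)).1 le_rfl)

lemma relType_span_singleton_mul [IsDomain R] [IsNoetherianRing R] {a : R} (ha : a ≠ 0)
    (J : Ideal R) : relType (Ideal.span {a} * J) = relType J := by
  obtain ⟨n, f, rfl⟩ := exists_fin_span_eq J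
  refine relType_eq_of_forall_le_iff fun N hN => ?_
  have h : Ideal.span (Set.range fun i => a * f i) =
      Ideal.span {a} * Ideal.span (Set.range f) := by
    rw [Ideal.span_mul_span', Set.singleton_mul, ← Set.range_comp]
    rfl
  rw [relType_le_iff h hN, relType_le_iff rfl hN, reesKer_smul f ha]

lemma relType_eq_one_of_linearTypeFamily [IsNoetherianRing R] {n : ℕ} {f : Fin n → R}
    (hf : GenInDegLE (reesKer f) 1) : relType (Ideal.span (Set.range f)) = 1 :=
  le_antisymm ((relType_le_iff rfl le_rfl).2 hf) (one_le_relType _)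

/-- Removing isolated maximal components generated by regular sequences does not change the
relation type. -/
lemma relType_sInf_eq [IsNoetherianRing R] {n : ℕ} (hR : MaximalIdealsRegular R n)
    {F : Set (Ideal R)} (hF : F.Finite) (hanti : ∀ P ∈ F, ∀ Q ∈ F, P ≤ Q → P = Q) :
    relType (sInf F) = relType (sInf {P ∈ F | ¬ P.IsMaximal}) := by
  set J := sInf {P ∈ F | ¬ P.IsMaximal} with hJ
  obtain ⟨r, f, hf⟩ := exists_fin_span_eq (sInf F)
  obtain ⟨t, g, hg⟩ := exists_fin_span_eq J
  have hIJ : sInf F ≤ J := sInf_le_sInf fun P hP => hP.1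
  have hfI : ∀ i, f i ∈ sInf F := fun i => hf ▸ Ideal.subset_span ⟨i, rfl⟩
  have hgJ : ∀ j, g j ∈ J := fun j => hg ▸ Ideal.subset_span ⟨j, rfl⟩
  have hmem : ∀ m ∈ F, m.IsMaximal → ∃ s ∉ m, s ∈ J ∧ ∀ u ∈ m, s * u ∈ sInf F := by
    intro m hmF hm
    obtain ⟨s, hs, hsF⟩ := exists_notMem_forall_mem hm.isPrime
      (hF.subset (Set.sep_subset F (· ≠ m))) fun P hP hPm => hP.2 (hanti P hP.1 m hmF hPm)
    refine ⟨s, hs, Ideal.mem_sInf.2 fun {P} hP => hsF P ⟨hP.1, ?_⟩, fun u hu => ?_⟩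
    · rintro rfl
      exact hP.2 hm
    · rw [Ideal.mem_sInf]
      intro P hP
      by_cases hPm : P = m
      · exact hPm ▸ Ideal.mul_mem_left _ _ hu
      · exact Ideal.mul_mem_right _ _ (hsF P ⟨hP, hPm⟩)
  have hnotMem : ∀ m ∉ F, m.IsMaximal → ∃ s ∉ m, ∀ u ∈ J, s * u ∈ sInf F := by
    intro m hmF hm
    obtain ⟨s, hs, hsF⟩ := exists_notMem_forall_mem hm.isPrime
      (hF.subset (Set.sep_subset F (·.IsMaximal))) fun P hP hPm =>
        hmF (hP.2.eq_of_le hm.ne_top hPm ▸ hP.1)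
    refine ⟨s, hs, fun u hu => ?_⟩
    rw [Ideal.mem_sInf]
    intro P hP
    by_cases hPm : P.IsMaximal
    · exact Ideal.mul_mem_right _ _ (hsF P ⟨hP, hPm⟩)
    · exact Ideal.mul_mem_left _ _ (Ideal.mem_sInf.1 hu ⟨hP, hPm⟩)
  refine relType_eq_of_forall_le_iff fun N hN => ?_
  rw [relType_le_iff hf hN, relType_le_iff hg hN]
  constructor
  · refine fun H => genInDegLE_of_locally hN fun m hm => ?_
    by_cases hmF : m ∈ F
    · obtain ⟨s, hs, hsJ, -⟩ := hmem m hmF hm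
      refine ⟨1, ![1], s, hs, fun i => ?_, fun j => ?_, genInDegLE_one.mono hN⟩
      · rw [span_range_one]
        trivial
      · rw [hg]
        exact Ideal.mul_mem_right _ _ hsJ
    · obtain ⟨s, hs, hsJ⟩ := hnotMem m hmF hm
      refine ⟨r, f, s, hs, fun i => ?_, fun j => ?_, H⟩
      · rw [hf]
        exact hsJ _ (hgJ i)
      · rw [hg]
        exact Ideal.mul_mem_left _ _ (hIJ (hfI j))
  · refine fun H => genInDegLE_of_locally hN fun m hm => ?_
    by_cases hmF : m ∈ F
    · obtain ⟨s, hs, -, hsm⟩ := hmem m hmF hm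
      obtain ⟨-, e, he, hreg⟩ := hR m hm
      refine ⟨n, e, s, hs, fun i => ?_, fun j => ?_, hreg.linearTypeFamily.1.mono hN⟩
      · rw [he]
        exact Ideal.mul_mem_left _ _ (Ideal.mem_sInf.1 (hfI i) hmF)
      · rw [hf]
        exact hsm _ (he ▸ Ideal.subset_span ⟨j, rfl⟩)
    · obtain ⟨s, hs, hsJ⟩ := hnotMem m hmF hm
      refine ⟨t, g, s, hs, fun i => ?_, fun j => ?_, H⟩
      · rw [hg]
        exact Ideal.mul_mem_left _ _ (hIJ (hfI i))
      · rw [hf]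
        exact hsJ _ (hgJ j)

/-- The principal components of an intersection of incomparable primes can be factored out. -/
lemma exists_span_singleton_mul_eq_sInf [IsDomain R] [UniqueFactorizationMonoid R]
    {F : Set (Ideal R)} (hF : F.Finite) (hprime : ∀ P ∈ F, P.IsPrime)
    (hanti : ∀ P ∈ F, ∀ Q ∈ F, P ≤ Q → P = Q) (S : Set (Ideal R))
    (hprinc : ∀ P ∈ F, P ∉ S → ∃ g, Prime g ∧ P = Ideal.span {g}) :
    ∃ a : R, a ≠ 0 ∧ sInf F = Ideal.span {a} * sInf {P ∈ F | P ∈ S} := by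
  classical
  choose! g hg hPg using hprinc
  let F₁ : Finset (Ideal R) := (hF.subset (Set.sep_subset F (· ∉ S))).toFinset
  have hF₁ : ∀ P, P ∈ F₁ ↔ P ∈ F ∧ P ∉ S := fun P => by
    simp [F₁]
  have hgne : ∀ P ∈ F₁, ∀ Q ∈ F, g P ∈ Q → P = Q := by
    intro P hP Q hQ hPQ
    have h := (hF₁ P).1 hP
    refine hanti P h.1 Q hQ ?_
    rw [hPg P h.1 h.2, Ideal.span_singleton_le_iff_mem]
    exact hPQ
  refine ⟨∏ P ∈ F₁, g P, Finset.prod_ne_zero_iff.2 fun P hP =>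
    (hg P ((hF₁ P).1 hP).1 ((hF₁ P).1 hP).2).ne_zero, le_antisymm ?_ ?_⟩
  · intro w hw
    rw [Ideal.mem_sInf] at hw
    have hdvd : ∏ P ∈ F₁, g P ∣ w := by
      refine Finset.prod_dvd_of_isRelPrime ?_ fun P hP => ?_
      · intro P hP Q hQ hPQ
        have h := (hF₁ P).1 hP
        refine ((hg P h.1 h.2).irreducible.isRelPrime_iff_not_dvd).2 fun hd => hPQ ?_
        have h' := (hF₁ Q).1 hQ
        have hmem : g Q ∈ P := by
          rw [hPg P h.1 h.2]
          exact Ideal.mem_span_singleton.2 hd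
        exact (hgne Q hQ P h.1 hmem).symm
      · have h := (hF₁ P).1 hP
        have hwP := hw h.1
        rw [hPg P h.1 h.2] at hwP
        exact Ideal.mem_span_singleton.1 hwP
    obtain ⟨b, rfl⟩ := hdvd
    refine Ideal.mul_mem_mul (Ideal.mem_span_singleton_self _) (Ideal.mem_sInf.2 fun {Q} hQ => ?_)
    have hQp := hprime Q hQ.1
    refine (hQp.mem_or_mem (hw hQ.1)).resolve_left fun hmem => ?_
    obtain ⟨P, hP, hPQ⟩ := hQp.prod_mem_iff.1 hmem
    exact ((hF₁ P).1 hP).2 (hgne P hP Q hQ.1 hPQ ▸ hQ.2)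
  · rw [Ideal.span_singleton_mul_le_iff]
    intro b hb
    rw [Ideal.mem_sInf] at hb ⊢
    intro P hP
    by_cases hPS : P ∈ S
    · exact Ideal.mul_mem_left _ _ (hb ⟨hP, hPS⟩)
    · refine Ideal.mul_mem_right _ _ (Ideal.mem_of_dvd P
        (Finset.dvd_prod_of_mem g ((hF₁ P).2 ⟨hP, hPS⟩)) ?_)
      exact (hPg P hP hPS).ge (Ideal.mem_span_singleton_self (g P))

lemma MaximalIdealsRegular.exists_eq_span_singleton [IsDomain R] [UniqueFactorizationMonoid R]
    (hR : MaximalIdealsRegular R 3) {P : Ideal R} [hP : P.IsPrime] (hP0 : P ≠ ⊥)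
    (hmax : ¬ P.IsMaximal) (hht : P.height ≠ 2) : ∃ g, Prime g ∧ P = Ideal.span {g} := by
  obtain ⟨g, hg, hgp⟩ := hP.exists_mem_prime_of_ne_bot hP0
  refine ⟨g, hgp, Ideal.eq_span_singleton_of_height_eq_one ?_ hg hgp⟩
  have h3 := hR.height_lt hmax
  have h0 : P.height ≠ 0 := fun h => hP0 (Ideal.height_eq_zero_iff_eq_bot.1 h)
  generalize P.height = d at h3 h0 hht
  induction d with
  | top => simp at h3
  | coe d =>
    norm_cast at *
    omega

end Assembly

/-- **Proposition.** Let `I` be a proper radical ideal of `k[x,y,z]`. Then either `rt(I) = 1`,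
or `rt(I) = rt(I₂)` where the second equidimensional component `I₂ ≠ R` is syzygetic.
Moreover, either `rt(I) = 1` or `rt(I) ≥ 3`. -/
theorem relType_radical_three_variables {k : Type*} [Field k]
    (I : Ideal (MvPolynomial (Fin 3) k)) (hI : I ≠ ⊤) (hrad : I.IsRadical) :
    (relType I = 1 ∨
      (relType I = relType (equidimComponent I 2) ∧ equidimComponent I 2 ≠ ⊤ ∧
        Syzygetic (equidimComponent I 2))) ∧
    (relType I = 1 ∨ 3 ≤ relType I) := by
  have hR := maximalIdealsRegular_mvPolynomial k 3
  by_cases hI0 : I = ⊥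
  · have h1 : relType I = 1 := by
      have h := relType_eq_one_of_linearTypeFamily
        (linearTypeFamily_of_isEmpty (![] : Fin 0 → MvPolynomial (Fin 3) k)).1
      rwa [Set.range_eq_empty, Ideal.span_empty, ← hI0] at h
    exact ⟨Or.inl h1, Or.inl h1⟩
  have hprime : ∀ P ∈ I.minimalPrimes, P.IsPrime := fun P hP => hP.1.1
  have hF : I.minimalPrimes.Finite := Ideal.finite_minimalPrimes_of_isNoetherianRing _ I
  have hanti : ∀ P ∈ I.minimalPrimes, ∀ Q ∈ I.minimalPrimes, P ≤ Q → P = Q :=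
    fun P hP Q hQ hle => le_antisymm hle (hQ.2 hP.1 hle)
  have hsub : {P ∈ I.minimalPrimes | ¬ P.IsMaximal} ⊆ I.minimalPrimes := Set.sep_subset _ _
  obtain ⟨a, ha, haI⟩ := exists_span_singleton_mul_eq_sInf (hF.subset hsub)
    (fun P hP => hprime P hP.1) (fun P hP Q hQ => hanti P hP.1 Q hQ.1)
    {P | idealHeight P = ((2 : ℕ) : ℕ∞)} fun P hP hP2 => by
      have := hprime P hP.1
      refine hR.exists_eq_span_singleton (fun h => hI0 ?_) hP.2 fun h => hP2 ?_
      · exact le_bot_iff.1 (hP.1.1.2.trans h.le)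
      · simpa [idealHeight_eq_height] using h
  have hcomp : {P ∈ {P ∈ I.minimalPrimes | ¬ P.IsMaximal} |
      P ∈ {P | idealHeight P = ((2 : ℕ) : ℕ∞)}} =
      {P | P ∈ I.minimalPrimes ∧ idealHeight P = ((2 : ℕ) : ℕ∞)} := by
    refine Set.ext fun P => ⟨fun h => ⟨h.1.1, h.2⟩, fun h => ⟨⟨h.1, fun hmax => ?_⟩, h.2⟩⟩
    have h2 := h.2
    rw [idealHeight_eq_height, (hR P hmax).1] at h2
    norm_num at h2
  have heq : relType I = relType (equidimComponent I 2) := by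
    conv_lhs => rw [← hrad.radical, ← Ideal.sInf_minimalPrimes]
    rw [relType_sInf_eq hR hF hanti, haI, relType_span_singleton_mul ha, hcomp, equidimComponent]
  have hsyz : Syzygetic (equidimComponent I 2) := by
    refine syzygetic_sInf hR (hF.subset fun P hP => hP.1) (fun P hP => hprime P hP.1)
      fun P hP => ?_
    have := hprime P hP.1
    rw [← idealHeight_eq_height, hP.2]
    rfl
  refine ⟨?_, heq ▸ hsyz.relType_eq_one_or⟩
  by_cases htop : equidimComponent I 2 = ⊤
  · left
    rw [heq, htop, ← span_range_one]
    exact relType_eq_one_of_linearTypeFamily genInDegLE_one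
  · exact Or.inr ⟨heq, htop, hsyz⟩
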